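/- arXiv:2204.00058 — 4 statements merged into one kernel-verified Lean document; each statement's English description precedes it below -/
import Mathlib

section
/- Let p1, p2 > 1 and p = p1*p2/(p1+p2). There exists a constant C < ∞ such that ‖S²(f,g)‖_{L^p(ℝ)} ≤ C ‖f‖_{L^{p1}(ℝ)} ‖g‖_{L^{p2}(ℝ)} for all Schwartz functions f and g if and only if p1 > 2 and p2 > 2. -/
open MeasureTheory Real Set
open scoped ENNReal NNReal

/-- The bilinear spherical maximal function in dimension one:
`S²(f,g)(x) = sup_{t>0} (2π)⁻¹ ∫_0^{2π} |f(x - t cos θ)| |g(x - t sin θ)| dθ`. -/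
noncomputable def S2 (f g : ℝ → ℝ) (x : ℝ) : ℝ≥0∞ :=
  ⨆ (t : ℝ) (_ : 0 < t),
    (ENNReal.ofReal (2 * π))⁻¹ *
      ∫⁻ θ in Set.Ioc (0 : ℝ) (2 * π),
        ENNReal.ofReal (|f (x - t * Real.cos θ)| * |g (x - t * Real.sin θ)|)

/-- The normalized surface measure on the unit sphere `S^{m-1} ⊆ ℝ^m`. -/
noncomputable def sphMeasure (m : ℕ) :
    Measure (Metric.sphere (0 : EuclideanSpace ℝ (Fin m)) 1) :=
  ((volume : Measure (EuclideanSpace ℝ (Fin m))).toSphere Set.univ)⁻¹ •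
    (volume : Measure (EuclideanSpace ℝ (Fin m))).toSphere

/-- The multilinear spherical average
`S^m_t(|f₁|,…,|f_m|)(x) = ∫_{S^{m-1}} ∏ |f_i(x - t y_i)| dσ_{m-1}(y)`. -/
noncomputable def sphAvg (m : ℕ) (f : Fin m → ℝ → ℝ) (t x : ℝ) : ℝ≥0∞ :=
  ∫⁻ y : Metric.sphere (0 : EuclideanSpace ℝ (Fin m)) 1,
    ∏ i, ENNReal.ofReal |f i (x - t * (y : EuclideanSpace ℝ (Fin m)) i)| ∂(sphMeasure m)

/-- The multilinear spherical maximal function `S^m(f₁,…,f_m)(x) = sup_{t>0} S^m_t(|f₁|,…,|f_m|)(x)`. -/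
noncomputable def Sm (m : ℕ) (f : Fin m → ℝ → ℝ) (x : ℝ) : ℝ≥0∞ :=
  ⨆ (t : ℝ) (_ : 0 < t), sphAvg m f t x

/-- The `L^p(ℝ)` norm of an `ℝ≥0∞`-valued function. -/
noncomputable def lpNorm (p : ℝ≥0∞) (F : ℝ → ℝ≥0∞) : ℝ≥0∞ :=
  if p = ∞ then essSup F volume
  else (∫⁻ x, F x ^ p.toReal) ^ (1 / p.toReal)

/-- The weak `L^{p,∞}(ℝ)` quasinorm of an `ℝ≥0∞`-valued function. -/
noncomputable def wLpNorm (p : ℝ≥0∞) (F : ℝ → ℝ≥0∞) : ℝ≥0∞ :=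
  ⨆ (l : ℝ≥0∞) (_ : 0 < l), l * (volume {x | l < F x}) ^ (1 / p.toReal)

/-- The `k`-linear Hardy–Littlewood maximal function
`M^k(g₁,…,g_k)(x) = sup_{t>0} ∫_{B^k(0,1)} ∏ |g_i(x - t y_i)| dy`. -/
noncomputable def Mk (k : ℕ) (g : Fin k → ℝ → ℝ) (x : ℝ) : ℝ≥0∞ :=
  ⨆ (t : ℝ) (_ : 0 < t),
    ∫⁻ y in Metric.ball (0 : EuclideanSpace ℝ (Fin k)) 1,
      ∏ i, ENNReal.ofReal |g i (x - t * y i)| ∂volume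


/-- uncentered maximal function -/
noncomputable def MM (h : ℝ → ℝ≥0∞) (x : ℝ) : ℝ≥0∞ :=
  ⨆ (a : ℝ) (b : ℝ) (_ : a < x ∧ x < b), (ENNReal.ofReal (b - a))⁻¹ * ∫⁻ y in Ioo a b, h y

lemma le_MM (h : ℝ → ℝ≥0∞) {x a b : ℝ} (ha : a < x) (hb : x < b) :
    (∫⁻ y in Ioo a b, h y) ≤ ENNReal.ofReal (b - a) * MM h x := by
  have h1 : (ENNReal.ofReal (b - a))⁻¹ * ∫⁻ y in Ioo a b, h y ≤ MM h x :=
    le_iSup_of_le a (le_iSup_of_le b (le_iSup_of_le ⟨ha, hb⟩ le_rfl))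
  have h0 : ENNReal.ofReal (b - a) ≠ 0 := by
    simp only [ne_eq, ENNReal.ofReal_eq_zero, not_le]; linarith
  calc _ = ENNReal.ofReal (b - a) * ((ENNReal.ofReal (b - a))⁻¹ * ∫⁻ y in Ioo a b, h y) := by
        rw [← mul_assoc, ENNReal.mul_inv_cancel h0 ENNReal.ofReal_ne_top, one_mul]
    _ ≤ _ := by gcongr

lemma lt_MM_iff (h : ℝ → ℝ≥0∞) (x : ℝ) (l : ℝ≥0∞) :
    l < MM h x ↔ ∃ a b, (a < x ∧ x < b) ∧ l < (ENNReal.ofReal (b - a))⁻¹ * ∫⁻ y in Ioo a b, h y := by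
  simp only [MM, lt_iSup_iff, exists_prop]

lemma measurable_MM (h : ℝ → ℝ≥0∞) : Measurable (MM h) := by
  apply measurable_of_Ioi
  intro l
  apply IsOpen.measurableSet
  rw [isOpen_iff_mem_nhds]
  intro x hx
  obtain ⟨a, b, hab, hl⟩ := (lt_MM_iff h x l).1 hx
  filter_upwards [Ioo_mem_nhds hab.1 hab.2] with y hy
  exact (lt_MM_iff h y l).2 ⟨a, b, hy, hl⟩

lemma MM_le_of_le (h : ℝ → ℝ≥0∞) (h' : ℝ → ℝ≥0∞) (c : ℝ≥0∞) (H : ∀ y, h y ≤ c + h' y) (x : ℝ) :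
    MM h x ≤ c + MM h' x := by
  refine iSup_le fun a => iSup_le fun b => iSup_le fun hab => ?_
  have h0 : ENNReal.ofReal (b - a) ≠ 0 := by
    simp only [ne_eq, ENNReal.ofReal_eq_zero, not_le]; linarith [hab.1, hab.2]
  have h1 : ∫⁻ y in Ioo a b, h y ≤ ENNReal.ofReal (b - a) * (c + MM h' x) := by
    calc ∫⁻ y in Ioo a b, h y ≤ ∫⁻ y in Ioo a b, (c + h' y) := lintegral_mono H
      _ = (∫⁻ y in Ioo a b, c) + ∫⁻ y in Ioo a b, h' y := lintegral_add_left measurable_const _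
      _ ≤ c * ENNReal.ofReal (b - a) + ENNReal.ofReal (b - a) * MM h' x := by
          gcongr
          · simp
          · exact le_MM h' hab.1 hab.2
      _ = _ := by ring
  calc _ ≤ (ENNReal.ofReal (b - a))⁻¹ * (ENNReal.ofReal (b - a) * (c + MM h' x)) := by gcongr
    _ = _ := by rw [← mul_assoc, ENNReal.inv_mul_cancel h0 ENNReal.ofReal_ne_top, one_mul]

lemma weak_MM (h : ℝ → ℝ≥0∞) (l : ℝ≥0∞) (hl : l ≠ 0) (hl' : l ≠ ∞) :
    l * volume {x | l < MM h x} ≤ 4 * ∫⁻ y, h y := by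
  by_cases hI : ∫⁻ y, h y = ∞
  · rw [hI]; simp
  let T : Set (ℝ × ℝ) :=
    {c | 0 < c.2 ∧ l * ENNReal.ofReal (2 * c.2) ≤ ∫⁻ y in Metric.ball c.1 c.2, h y}
  have hR : ∀ c ∈ T, c.2 ≤ ((∫⁻ y, h y) / l).toReal := by
    intro c hc
    have h1 : l * ENNReal.ofReal (2 * c.2) ≤ ∫⁻ y, h y :=
      hc.2.trans (setLIntegral_le_lintegral _ _)
    have h2 : ENNReal.ofReal (2 * c.2) ≤ (∫⁻ y, h y) / l := by
      rw [ENNReal.le_div_iff_mul_le (Or.inl hl) (Or.inl hl'), mul_comm]; exact h1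
    have h3 := (ENNReal.ofReal_le_iff_le_toReal (ENNReal.div_ne_top hI hl)).1 h2
    linarith [hc.1]
  obtain ⟨u, huT, hud, huc⟩ := Vitali.exists_disjoint_subfamily_covering_enlargement_ball T
    (fun c => c.1) (fun c => c.2) _ hR 4 (by norm_num)
  have hcount : u.Countable := by
    refine hud.countable_of_isOpen (fun c _ => Metric.isOpen_ball) ?_
    intro c hc
    exact Metric.nonempty_ball.2 (huT hc).1
  have hsub : {x | l < MM h x} ⊆ ⋃ c ∈ u, Metric.ball c.1 (4 * c.2) := by
    intro x hx
    obtain ⟨a, b, hab, hlt⟩ := (lt_MM_iff h x l).1 hx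
    have h0 : ENNReal.ofReal (b - a) ≠ 0 := by
      simp only [ne_eq, ENNReal.ofReal_eq_zero, not_le]; linarith [hab.1, hab.2]
    have hb : Metric.ball ((a + b) / 2) ((b - a) / 2) = Ioo a b := by
      rw [Real.ball_eq_Ioo]; congr 1 <;> ring
    have hT : ((a + b) / 2, (b - a) / 2) ∈ T := by
      refine ⟨by simp only; linarith [hab.1, hab.2], ?_⟩
      simp only [hb]
      calc _ = l * ENNReal.ofReal (b - a) := by congr 2; ring
        _ ≤ ((ENNReal.ofReal (b - a))⁻¹ * ∫⁻ y in Ioo a b, h y) * ENNReal.ofReal (b - a) := by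
            gcongr
        _ = ∫⁻ y in Ioo a b, h y := by
            rw [mul_comm, ← mul_assoc, ENNReal.mul_inv_cancel h0 ENNReal.ofReal_ne_top, one_mul]
    obtain ⟨c, hc, hcb⟩ := huc _ hT
    simp only [hb] at hcb
    exact mem_biUnion hc (hcb hab)
  have hc' := hcount.to_subtype
  calc l * volume {x | l < MM h x} ≤ l * ∑' c : u, volume (Metric.ball c.1.1 (4 * c.1.2)) := by
        gcongr
        refine (measure_mono hsub).trans ?_
        exact measure_biUnion_le volume hcount _
    _ = ∑' c : u, l * volume (Metric.ball c.1.1 (4 * c.1.2)) := ENNReal.tsum_mul_left.symm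
    _ ≤ ∑' c : u, 4 * ∫⁻ y in Metric.ball c.1.1 c.1.2, h y := by
        refine ENNReal.tsum_le_tsum fun c => ?_
        rw [Real.volume_ball]
        calc _ = 4 * (l * ENNReal.ofReal (2 * c.1.2)) := by
              rw [show 2 * (4 * c.1.2) = 4 * (2 * c.1.2) by ring,
                ENNReal.ofReal_mul (p := 4) (by norm_num)]
              simp only [ENNReal.ofReal_ofNat]
              ring
          _ ≤ _ := by gcongr; exact (huT c.2).2
    _ = 4 * ∑' c : u, ∫⁻ y in Metric.ball c.1.1 c.1.2, h y := ENNReal.tsum_mul_left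
    _ = 4 * ∫⁻ y in ⋃ c ∈ u, Metric.ball c.1 c.2, h y := by
        rw [lintegral_biUnion hcount (fun c _ => measurableSet_ball) hud]
    _ ≤ _ := mul_le_mul_right (setLIntegral_le_lintegral _ _) 4

lemma weak_MM' (h : ℝ → ℝ≥0∞) (hm : Measurable h) (t : ℝ) (ht : 0 < t) :
    volume {x | ENNReal.ofReal t < MM h x} ≤
      8 * ENNReal.ofReal t⁻¹ * ∫⁻ y in {y | ENNReal.ofReal t < 2 * h y}, h y := by
  set l := ENNReal.ofReal (t / 2) with hl
  have hl2 : ENNReal.ofReal t = l + l := by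
    rw [hl, ← ENNReal.ofReal_add (by positivity) (by positivity)]; congr 1; ring
  set E := {y | ENNReal.ofReal t < 2 * h y}
  have hE : MeasurableSet E := measurableSet_lt measurable_const (hm.const_mul 2)
  have hl0 : l ≠ 0 := by simp [hl, ht]
  have hlt : l ≠ ∞ := ENNReal.ofReal_ne_top
  have hsub : {x | ENNReal.ofReal t < MM h x} ⊆ {x | l < MM (E.indicator h) x} := by
    intro x hx
    have h1 := MM_le_of_le h (E.indicator h) l (fun y => by
      by_cases hy : y ∈ E
      · simp [hy]
      · simp only [hy, not_false_eq_true, indicator_of_notMem, add_zero]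
        have : 2 * h y ≤ 2 * l := by rw [two_mul l, ← hl2]; exact not_lt.1 hy
        exact (ENNReal.mul_le_mul_iff_right (by norm_num) (by norm_num)).1 this) x
    have h2 : l + l < l + MM (E.indicator h) x := by rw [← hl2]; exact lt_of_lt_of_le hx h1
    exact lt_of_add_lt_add_left h2
  have h3 := weak_MM (E.indicator h) l hl0 hlt
  rw [lintegral_indicator hE] at h3
  have h4 : 8 * ENNReal.ofReal t⁻¹ = l⁻¹ * 4 := by
    rw [hl, ← ENNReal.ofReal_inv_of_pos (by positivity)]
    rw [← ENNReal.ofReal_ofNat 8, ← ENNReal.ofReal_ofNat 4, ← ENNReal.ofReal_mul (by norm_num), ← ENNReal.ofReal_mul (by positivity)]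
    congr 1; field_simp; norm_num
  calc _ ≤ volume {x | l < MM (E.indicator h) x} := measure_mono hsub
    _ = l⁻¹ * (l * volume {x | l < MM (E.indicator h) x}) := by
        rw [← mul_assoc, ENNReal.inv_mul_cancel hl0 hlt, one_mul]
    _ ≤ l⁻¹ * (4 * ∫⁻ y in E, h y) := by gcongr
    _ = _ := by rw [h4, mul_assoc]

lemma strong_MM {q : ℝ} (hq : 1 < q) : ∃ C : ℝ≥0∞, C ≠ ∞ ∧ ∀ (H : ℝ → ℝ) (B : ℝ),
    Measurable H → (∀ x, 0 ≤ H x) → (∀ x, H x ≤ B) →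
    ∫⁻ x, MM (fun y => ENNReal.ofReal (H y)) x ^ q ≤ C * ∫⁻ x, ENNReal.ofReal (H x) ^ q := by
  refine ⟨ENNReal.ofReal q * (8 * (ENNReal.ofReal (q - 1))⁻¹ * 2 ^ (q - 1)), ?_, ?_⟩
  · refine ENNReal.mul_ne_top ENNReal.ofReal_ne_top (ENNReal.mul_ne_top (ENNReal.mul_ne_top (by norm_num) ?_) ?_)
    · simp [hq]
    · exact ENNReal.rpow_ne_top_of_nonneg (by linarith) (by norm_num)
  intro H B hHm hH0 hHB
  set h : ℝ → ℝ≥0∞ := fun y => ENNReal.ofReal (H y) with hh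
  have hm : Measurable h := hHm.ennreal_ofReal
  have hfin : ∀ x, MM h x ≠ ∞ := by
    intro x
    have := MM_le_of_le h (fun _ => 0) (ENNReal.ofReal B) (fun y => by
      simp only [add_zero, hh]; exact ENNReal.ofReal_le_ofReal (hHB y)) x
    have h0 : MM (fun _ => 0) x = 0 := by simp [MM]
    rw [h0, add_zero] at this
    exact ne_top_of_le_ne_top ENNReal.ofReal_ne_top this
  have e1 : ∀ x, MM h x ^ q = ENNReal.ofReal ((MM h x).toReal ^ q) := by
    intro x
    rw [← ENNReal.ofReal_rpow_of_nonneg ENNReal.toReal_nonneg (by linarith), ENNReal.ofReal_toReal (hfin x)]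
  simp_rw [e1]
  rw [lintegral_rpow_eq_lintegral_meas_lt_mul volume (Filter.Eventually.of_forall fun x => ENNReal.toReal_nonneg)
    (measurable_MM h).ennreal_toReal.aemeasurable (by linarith : 0 < q)]
  set ν := volume.withDensity h with hν
  have hset : ∀ t : ℝ, 0 < t → {y | ENNReal.ofReal t < 2 * h y} = {y | t < 2 * H y} := by
    intro t ht
    ext y
    simp only [hh, mem_ofPred_eq]
    rw [← ENNReal.ofReal_ofNat 2, ← ENNReal.ofReal_mul (by norm_num), ENNReal.ofReal_lt_ofReal_iff_of_nonneg ht.le]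
  have key := lintegral_rpow_eq_lintegral_meas_lt_mul ν (f := fun y => 2 * H y)
    (Filter.Eventually.of_forall fun x => by have := hH0 x; simp only [Pi.zero_apply]; positivity)
    (hHm.const_mul 2).aemeasurable (by linarith : 0 < q - 1)
  have hq1 : ENNReal.ofReal (q - 1) ≠ 0 := by simp [hq]
  have step : ∫⁻ t in Ioi (0:ℝ), volume {a | t < (MM h a).toReal} * ENNReal.ofReal (t ^ (q - 1))
      ≤ 8 * ∫⁻ t in Ioi (0:ℝ), ν {a | t < 2 * H a} * ENNReal.ofReal (t ^ (q - 1 - 1)) := by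
    rw [← lintegral_const_mul' _ _ (by norm_num)]
    refine setLIntegral_mono' measurableSet_Ioi fun t ht => ?_
    have ht : 0 < t := ht
    have s1 : {a | t < (MM h a).toReal} = {a | ENNReal.ofReal t < MM h a} := by
      ext a
      simp only [mem_ofPred_eq]
      rw [ENNReal.ofReal_lt_iff_lt_toReal ht.le (hfin a)]
    have s2 : ν {a | t < 2 * H a} = ∫⁻ y in {y | ENNReal.ofReal t < 2 * h y}, h y := by
      rw [hset t ht, hν, withDensity_apply _ (measurableSet_lt measurable_const (hHm.const_mul 2))]
    rw [s1, s2]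
    calc _ ≤ (8 * ENNReal.ofReal t⁻¹ * ∫⁻ y in {y | ENNReal.ofReal t < 2 * h y}, h y) * ENNReal.ofReal (t ^ (q - 1)) := by
          gcongr; exact weak_MM' h hm t ht
      _ = 8 * ((∫⁻ y in {y | ENNReal.ofReal t < 2 * h y}, h y) * (ENNReal.ofReal t⁻¹ * ENNReal.ofReal (t ^ (q - 1)))) := by ring
      _ = _ := by
          rw [← ENNReal.ofReal_mul (by positivity), rpow_sub_one ht.ne' (q - 1)]
          rw [inv_mul_eq_div]
  have key2 : ∫⁻ t in Ioi (0:ℝ), ν {a | t < 2 * H a} * ENNReal.ofReal (t ^ (q - 1 - 1))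
      = (ENNReal.ofReal (q - 1))⁻¹ * (2 ^ (q - 1) * ∫⁻ x, h x ^ q) := by
    have : ∫⁻ ω, ENNReal.ofReal ((2 * H ω) ^ (q - 1)) ∂ν = 2 ^ (q - 1) * ∫⁻ x, h x ^ q := by
      rw [hν, lintegral_withDensity_eq_lintegral_mul _ hm (by fun_prop), ← lintegral_const_mul _ (hm.pow_const q)]
      congr 1
      ext y
      simp only [Pi.mul_apply, hh]
      have := hH0 y
      rw [← ENNReal.ofReal_rpow_of_nonneg (by positivity) (by linarith), ENNReal.ofReal_mul (by norm_num),
        ENNReal.mul_rpow_of_nonneg _ _ (by linarith)]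
      rw [show (ENNReal.ofReal (H y)) ^ q = ENNReal.ofReal (H y) ^ (1 + (q - 1)) by congr 1; ring,
        ENNReal.rpow_add_of_nonneg _ _ (by norm_num) (by linarith), ENNReal.rpow_one]
      simp only [ENNReal.ofReal_ofNat]
      ring
    rw [← this, key, ← mul_assoc, ENNReal.inv_mul_cancel hq1 ENNReal.ofReal_ne_top, one_mul]
  calc _ ≤ ENNReal.ofReal q * (8 * ∫⁻ t in Ioi (0:ℝ), ν {a | t < 2 * H a} * ENNReal.ofReal (t ^ (q - 1 - 1))) := by
        gcongr
    _ = _ := by rw [key2]; ring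

lemma cov_piece (φ φ' : ℝ → ℝ) (s : Set ℝ) (hs : MeasurableSet s)
    (hd : ∀ x, HasDerivAt φ (φ' x) x) (hi : InjOn φ s) (hb : ∀ x, φ x ∈ Icc (-1 : ℝ) 1)
    (h : ℝ → ℝ≥0∞) :
    ∫⁻ θ in s, ENNReal.ofReal |φ' θ| * h (φ θ) ≤ ∫⁻ u in Icc (-1 : ℝ) 1, h u := by
  rw [← lintegral_image_eq_lintegral_abs_deriv_mul hs (fun x _ => (hd x).hasDerivWithinAt) hi h]
  exact lintegral_mono_set (image_subset_iff.2 fun x _ => hb x)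

lemma cov_cos (h : ℝ → ℝ≥0∞) :
    ∫⁻ θ in Ioc 0 (2 * π), ENNReal.ofReal |sin θ| * h (cos θ) ≤
      3 * ∫⁻ u in Icc (-1 : ℝ) 1, h u := by
  have hp := pi_pos
  have hb : ∀ x, cos x ∈ Icc (-1 : ℝ) 1 := fun x => ⟨neg_one_le_cos x, cos_le_one x⟩
  have e : ∀ θ, ENNReal.ofReal |sin θ| * h (cos θ) = ENNReal.ofReal |(- sin θ)| * h (cos θ) := by
    intro θ; rw [abs_neg]
  simp_rw [e]
  have h1 := cov_piece cos (fun x => - sin x) (Icc 0 π) measurableSet_Icc hasDerivAt_cos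
    injOn_cos hb h
  have h2 := cov_piece cos (fun x => - sin x) (Icc π (2 * π)) measurableSet_Icc hasDerivAt_cos
    (by
      intro a ha b hb hab
      have := injOn_cos (x₁ := 2 * π - a) (x₂ := 2 * π - b) ⟨by linarith [ha.2], by linarith [ha.1]⟩
        ⟨by linarith [hb.2], by linarith [hb.1]⟩ (by rw [cos_two_pi_sub, cos_two_pi_sub]; exact hab)
      linarith) hb h
  have hsub : Ioc 0 (2 * π) ⊆ Icc 0 π ∪ Icc π (2 * π) := by
    intro x hx
    rcases le_total x π with h | h
    · exact Or.inl ⟨hx.1.le, h⟩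
    · exact Or.inr ⟨h, hx.2⟩
  calc _ ≤ _ := lintegral_mono_set hsub
    _ ≤ _ := lintegral_union_le _ _ _
    _ ≤ _ := add_le_add h1 h2
    _ = 2 * ∫⁻ u in Icc (-1 : ℝ) 1, h u := (two_mul _).symm
    _ ≤ _ := by gcongr; norm_num

lemma cov_sin (h : ℝ → ℝ≥0∞) :
    ∫⁻ θ in Ioc 0 (2 * π), ENNReal.ofReal |cos θ| * h (sin θ) ≤
      3 * ∫⁻ u in Icc (-1 : ℝ) 1, h u := by
  have hp := pi_pos
  have hb : ∀ x, sin x ∈ Icc (-1 : ℝ) 1 := fun x => ⟨neg_one_le_sin x, sin_le_one x⟩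
  have h1 := cov_piece sin cos (Icc (-(π / 2)) (π / 2)) measurableSet_Icc hasDerivAt_sin
    injOn_sin hb h
  have h2 := cov_piece sin cos (Icc (π / 2) (3 * π / 2)) measurableSet_Icc hasDerivAt_sin
    (by
      intro a ha b hb hab
      have := injOn_sin (x₁ := π - a) (x₂ := π - b) ⟨by linarith [ha.2], by linarith [ha.1]⟩
        ⟨by linarith [hb.2], by linarith [hb.1]⟩ (by rw [sin_pi_sub, sin_pi_sub]; exact hab)
      linarith) hb h
  have h3 := cov_piece sin cos (Icc (3 * π / 2) (2 * π)) measurableSet_Icc hasDerivAt_sin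
    (by
      intro a ha b hb hab
      have := injOn_sin (x₁ := a - 2 * π) (x₂ := b - 2 * π) ⟨by linarith [ha.1], by linarith [ha.2]⟩
        ⟨by linarith [hb.1], by linarith [hb.2]⟩ (by rw [sin_sub_two_pi, sin_sub_two_pi]; exact hab)
      linarith) hb h
  have hsub : Ioc 0 (2 * π) ⊆ (Icc (-(π / 2)) (π / 2) ∪ Icc (π / 2) (3 * π / 2)) ∪ Icc (3 * π / 2) (2 * π) := by
    intro x hx
    rcases le_total x (π / 2) with h | h
    · exact Or.inl (Or.inl ⟨by linarith [hx.1], h⟩)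
    rcases le_total x (3 * π / 2) with h' | h'
    · exact Or.inl (Or.inr ⟨h, h'⟩)
    · exact Or.inr ⟨h', hx.2⟩
  calc _ ≤ _ := lintegral_mono_set hsub
    _ ≤ _ := lintegral_union_le _ _ _
    _ ≤ _ := add_le_add (lintegral_union_le _ _ _) le_rfl
    _ ≤ _ := add_le_add (add_le_add h1 h2) h3
    _ = _ := by ring

lemma avg_le_MM (h : ℝ → ℝ≥0∞) (x t ρ : ℝ) (ht : 0 < t) (hρ : 0 < ρ) :
    ∫⁻ v in Icc (-ρ) ρ, h (x - t * v) ≤ ENNReal.ofReal (4 * ρ) * MM h x := by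
  have h1 := lintegral_image_eq_lintegral_abs_deriv_mul (f := fun v => x - t * v) (f' := fun _ => - t)
    (s := Icc (-ρ) ρ) measurableSet_Icc
    (fun v _ => by
      have : HasDerivAt (fun v => x - t * v) (-t) v := by
        simpa using ((hasDerivAt_id v).const_mul t).const_sub x
      exact this.hasDerivWithinAt)
    (fun a _ b _ hab => by
      have : t * a = t * b := by simp only at hab; linarith
      exact mul_left_cancel₀ ht.ne' this) h
  have htρ := mul_pos ht hρ
  have h2 : ∫⁻ y in (fun v => x - t * v) '' Icc (-ρ) ρ, h y ≤
      ENNReal.ofReal ((x + 2 * (t * ρ)) - (x - 2 * (t * ρ))) * MM h x := by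
    refine le_trans (lintegral_mono_set ?_) (le_MM h (a := x - 2 * (t * ρ)) (b := x + 2 * (t * ρ))
      (by linarith) (by linarith))
    rintro _ ⟨v, hv, rfl⟩
    have a1 := mul_le_mul_of_nonneg_left hv.1 ht.le
    have a2 := mul_le_mul_of_nonneg_left hv.2 ht.le
    simp only [mem_Ioo]
    constructor <;> linarith
  rw [h1] at h2
  simp only [abs_neg, abs_of_pos ht] at h2
  rw [lintegral_const_mul' _ _ ENNReal.ofReal_ne_top,
    show (x + 2 * (t * ρ)) - (x - 2 * (t * ρ)) = t * (4 * ρ) by ring, ENNReal.ofReal_mul ht.le, mul_assoc] at h2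
  exact (ENNReal.mul_le_mul_iff_right (by simpa using ht) ENNReal.ofReal_ne_top).1 h2

lemma kernel_le_MM {b : ℝ} (hb0 : 0 < b) (hb1 : b < 1) : ∃ K : ℝ≥0∞, K ≠ ∞ ∧
    ∀ (h : ℝ → ℝ≥0∞) (x t : ℝ), Measurable h → 0 < t →
      ∫⁻ v in Icc (-1 : ℝ) 1, ENNReal.ofReal (|v| ^ (-b)) * h (x - t * v) ≤ K * MM h x := by
  set a : ℕ → ℝ := fun k => 2 ^ (b * (k + 1)) with ha
  set ρ : ℕ → ℝ := fun k => (1 / 2) ^ k with hρ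
  have hρ0 : ∀ k, 0 < ρ k := fun k => by simp only [hρ]; positivity
  have ha0 : ∀ k, 0 < a k := fun k => by simp only [ha]; positivity
  refine ⟨∑' k, ENNReal.ofReal (a k * (4 * ρ k)), ?_, ?_⟩
  · have e : ∀ k, a k * (4 * ρ k) = (4 * 2 ^ b) * ((2:ℝ) ^ (b - 1)) ^ k := by
      intro k
      simp only [ha, hρ]
      rw [← rpow_natCast ((2:ℝ) ^ (b - 1)) k, ← rpow_mul (by norm_num), one_div, inv_pow, ← rpow_natCast 2 k,
        ← rpow_neg (by norm_num), show (2:ℝ) ^ (b * (k + 1)) = 2 ^ b * 2 ^ (b * k) by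
          rw [← rpow_add (by norm_num)]; congr 1; ring,
        show (2:ℝ) ^ ((b - 1) * k) = 2 ^ (b * k) * 2 ^ (-(k:ℝ)) by
          rw [← rpow_add (by norm_num)]; congr 1; ring]
      ring
    have hs : Summable fun k => a k * (4 * ρ k) := by
      simp_rw [e]
      refine (summable_geometric_of_lt_one (by positivity) ?_).mul_left _
      exact rpow_lt_one_of_one_lt_of_neg (by norm_num) (by linarith)
    exact hs.tsum_ofReal_ne_top
  intro h x t hm ht
  have hpt : ∀ v ∈ Icc (-1 : ℝ) 1, ENNReal.ofReal (|v| ^ (-b)) * h (x - t * v) ≤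
      ∑' k, (Icc (-ρ k) (ρ k)).indicator (fun v => ENNReal.ofReal (a k) * h (x - t * v)) v := by
    intro v hv
    rcases eq_or_ne v 0 with rfl | hv0
    · simp [zero_rpow (by linarith : -b ≠ 0)]
    have hvp : 0 < |v| := abs_pos.2 hv0
    obtain ⟨k, hk1, hk2⟩ := exists_nat_pow_near_of_lt_one hvp (abs_le.2 hv) (by norm_num : (0:ℝ) < 1 / 2) (by norm_num)
    refine le_trans ?_ (ENNReal.le_tsum k)
    have hmem : v ∈ Icc (-ρ k) (ρ k) := abs_le.1 hk2
    rw [indicator_of_mem hmem]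
    gcongr
    calc |v| ^ (-b) ≤ ((1 / 2 : ℝ) ^ (k + 1)) ^ (-b) :=
          rpow_le_rpow_of_nonpos (by positivity) hk1.le (by linarith)
      _ = a k := by
          simp only [ha]
          rw [one_div, inv_pow, ← rpow_natCast 2 (k + 1), ← rpow_neg (by norm_num), ← rpow_mul (by norm_num)]
          congr 1; push_cast; ring
  calc _ ≤ ∫⁻ v in Icc (-1 : ℝ) 1, ∑' k, (Icc (-ρ k) (ρ k)).indicator (fun v => ENNReal.ofReal (a k) * h (x - t * v)) v :=
        setLIntegral_mono' measurableSet_Icc hpt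
    _ ≤ ∫⁻ v, ∑' k, (Icc (-ρ k) (ρ k)).indicator (fun v => ENNReal.ofReal (a k) * h (x - t * v)) v :=
        setLIntegral_le_lintegral _ _
    _ = ∑' k, ∫⁻ v, (Icc (-ρ k) (ρ k)).indicator (fun v => ENNReal.ofReal (a k) * h (x - t * v)) v := by
        rw [lintegral_tsum]
        intro k
        refine (Measurable.indicator ?_ measurableSet_Icc).aemeasurable
        fun_prop
    _ ≤ ∑' k, ENNReal.ofReal (a k * (4 * ρ k)) * MM h x := by
        refine ENNReal.tsum_le_tsum fun k => ?_
        rw [lintegral_indicator measurableSet_Icc, lintegral_const_mul' _ _ ENNReal.ofReal_ne_top,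
          ENNReal.ofReal_mul (ha0 k).le, mul_assoc]
        gcongr
        exact avg_le_MM h x t _ ht (hρ0 k)
    _ = _ := ENNReal.tsum_mul_right

lemma half_bound {s s' : ℝ} (hss : s.HolderConjugate s') (hs : 2 < s) :
    ∃ C : ℝ≥0∞, C ≠ ∞ ∧ ∀ (c σ : ℝ → ℝ), Measurable c → Measurable σ →
    (∀ h : ℝ → ℝ≥0∞, ∫⁻ θ in Ioc 0 (2 * π), ENNReal.ofReal |σ θ| * h (c θ) ≤
      3 * ∫⁻ u in Icc (-1 : ℝ) 1, h u) →
    (∀ h : ℝ → ℝ≥0∞, ∫⁻ θ in Ioc 0 (2 * π), ENNReal.ofReal |c θ| * h (σ θ) ≤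
      3 * ∫⁻ u in Icc (-1 : ℝ) 1, h u) →
    (∀ᵐ θ ∂(volume : Measure ℝ), σ θ ≠ 0) →
    ∀ (F G : ℝ → ℝ≥0∞) (x t : ℝ), Measurable F → Measurable G → 0 < t →
      ∫⁻ θ in Ioc 0 (2 * π) ∩ {θ | 1 ≤ 2 * |c θ|}, F (x - t * c θ) * G (x - t * σ θ) ≤
        C * (MM (fun y => F y ^ s) x ^ (1 / s) * MM (fun y => G y ^ s') x ^ (1 / s')) := by
  have hs0 : 0 < s := hss.pos
  have hs'0 : 0 < s' := hss.symm.pos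
  have hs'2 : s' < s := by
    have := hss.inv_add_inv_eq_one
    have h1 : s⁻¹ < 2⁻¹ := inv_strictAnti₀ (by norm_num) hs
    have h2 : (2:ℝ)⁻¹ < s'⁻¹ := by norm_num at *; linarith
    have := (inv_lt_inv₀ (by norm_num) hs'0).1 h2
    linarith
  obtain ⟨K, hK, hKb⟩ := kernel_le_MM (b := s' / s) (by positivity) ((div_lt_one hs0).2 hs'2)
  refine ⟨(3 * 4) ^ (1 / s) * (2 * (3 * K)) ^ (1 / s'), ?_, ?_⟩
  · refine ENNReal.mul_ne_top ?_ ?_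
    · exact ENNReal.rpow_ne_top_of_nonneg (by positivity) (by norm_num)
    · exact ENNReal.rpow_ne_top_of_nonneg (by positivity) (ENNReal.mul_ne_top (by norm_num) (ENNReal.mul_ne_top (by norm_num) hK))
  intro c σ hc hσ H1 H2 H3 F G x t hF hG ht
  set A := Ioc 0 (2 * π) ∩ {θ | 1 ≤ 2 * |c θ|} with hA
  have hAm : MeasurableSet A := measurableSet_Ioc.inter (measurableSet_le measurable_const (by fun_prop))
  set u : ℝ → ℝ≥0∞ := fun θ => ENNReal.ofReal (|σ θ| ^ (1 / s)) * F (x - t * c θ) with hu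
  set w : ℝ → ℝ≥0∞ := fun θ => ENNReal.ofReal (|σ θ| ^ (-(1 / s))) * G (x - t * σ θ) with hw
  have hum : Measurable u := by
    refine Measurable.mul (by fun_prop) (hF.comp (by fun_prop))
  have hwm : Measurable w := by
    refine Measurable.mul (by fun_prop) (hG.comp (by fun_prop))
  have e1 : ∫⁻ θ in A, F (x - t * c θ) * G (x - t * σ θ) = ∫⁻ θ in A, (u * w) θ := by
    refine lintegral_congr_ae (ae_restrict_of_ae ?_)
    filter_upwards [H3] with θ hθ
    have hp : 0 < |σ θ| := abs_pos.2 hθ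
    simp only [Pi.mul_apply, hu, hw]
    have : ENNReal.ofReal (|σ θ| ^ (1 / s)) * ENNReal.ofReal (|σ θ| ^ (-(1 / s))) = 1 := by
      rw [← ENNReal.ofReal_mul (by positivity), ← rpow_add hp]; simp
    calc _ = (ENNReal.ofReal (|σ θ| ^ (1 / s)) * ENNReal.ofReal (|σ θ| ^ (-(1 / s)))) * (F (x - t * c θ) * G (x - t * σ θ)) := by
          rw [this, one_mul]
      _ = _ := by ring
  have e2 : ∫⁻ θ in A, u θ ^ s ≤ (3 * 4) * MM (fun y => F y ^ s) x := by
    calc ∫⁻ θ in A, u θ ^ s ≤ ∫⁻ θ in Ioc 0 (2 * π), u θ ^ s := lintegral_mono_set inter_subset_left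
      _ = ∫⁻ θ in Ioc 0 (2 * π), ENNReal.ofReal |σ θ| * (fun v => F (x - t * v) ^ s) (c θ) := by
          congr 1; ext θ
          simp only [hu]
          rw [ENNReal.mul_rpow_of_nonneg _ _ hs0.le, ENNReal.ofReal_rpow_of_nonneg (by positivity) hs0.le,
            ← rpow_mul (abs_nonneg _), one_div, inv_mul_cancel₀ hs0.ne', rpow_one]
      _ ≤ 3 * ∫⁻ v in Icc (-1 : ℝ) 1, F (x - t * v) ^ s := H1 _
      _ ≤ 3 * (ENNReal.ofReal (4 * 1) * MM (fun y => F y ^ s) x) := by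
          gcongr; exact avg_le_MM (fun y => F y ^ s) x t 1 ht one_pos
      _ = _ := by rw [mul_one, ENNReal.ofReal_ofNat, mul_assoc]
  have e3 : ∫⁻ θ in A, w θ ^ s' ≤ (2 * (3 * K)) * MM (fun y => G y ^ s') x := by
    calc ∫⁻ θ in A, w θ ^ s' ≤ ∫⁻ θ in A, 2 * (ENNReal.ofReal |c θ| * (fun v => ENNReal.ofReal (|v| ^ (-(s' / s))) * G (x - t * v) ^ s') (σ θ)) := by
          refine setLIntegral_mono' hAm fun θ hθ => ?_
          have h1 : (1 : ℝ≥0∞) ≤ 2 * ENNReal.ofReal |c θ| := by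
            rw [← ENNReal.ofReal_ofNat 2, ← ENNReal.ofReal_mul (by norm_num), ENNReal.one_le_ofReal]
            exact hθ.2
          have h2 : w θ ^ s' = (fun v => ENNReal.ofReal (|v| ^ (-(s' / s))) * G (x - t * v) ^ s') (σ θ) := by
            simp only [hw]
            rw [ENNReal.mul_rpow_of_nonneg _ _ hs'0.le, ENNReal.ofReal_rpow_of_nonneg (by positivity) hs'0.le,
              ← rpow_mul (abs_nonneg _)]
            congr 4; ring
          rw [← h2, ← mul_assoc]
          exact le_mul_of_one_le_left' h1
      _ ≤ ∫⁻ θ in Ioc 0 (2 * π), 2 * (ENNReal.ofReal |c θ| * (fun v => ENNReal.ofReal (|v| ^ (-(s' / s))) * G (x - t * v) ^ s') (σ θ)) :=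
          lintegral_mono_set inter_subset_left
      _ = 2 * ∫⁻ θ in Ioc 0 (2 * π), (ENNReal.ofReal |c θ| * (fun v => ENNReal.ofReal (|v| ^ (-(s' / s))) * G (x - t * v) ^ s') (σ θ)) :=
          lintegral_const_mul' _ _ (by norm_num)
      _ ≤ 2 * (3 * (K * MM (fun y => G y ^ s') x)) := by
          gcongr
          refine (H2 (fun v => ENNReal.ofReal (|v| ^ (-(s' / s))) * G (x - t * v) ^ s')).trans ?_
          gcongr
          exact hKb (fun y => G y ^ s') x t (hG.pow_const _) ht
      _ = _ := by ring
  rw [e1]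
  calc _ ≤ _ := ENNReal.lintegral_mul_le_Lp_mul_Lq _ hss hum.aemeasurable hwm.aemeasurable
    _ ≤ ((3 * 4) * MM (fun y => F y ^ s) x) ^ (1 / s) * ((2 * (3 * K)) * MM (fun y => G y ^ s') x) ^ (1 / s') := by
        gcongr
    _ = _ := by
        rw [ENNReal.mul_rpow_of_nonneg (3 * 4) _ (by positivity), ENNReal.mul_rpow_of_nonneg (2 * (3 * K)) _ (by positivity)]
        exact mul_mul_mul_comm _ _ _ _

lemma ae_sin_ne : ∀ᵐ θ ∂(volume : Measure ℝ), sin θ ≠ 0 := by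
  have : {θ : ℝ | sin θ = 0} = range fun n : ℤ => (n : ℝ) * π := by
    ext θ; simp [sin_eq_zero_iff]
  have hc : {θ : ℝ | sin θ = 0}.Countable := by rw [this]; exact countable_range _
  exact hc.ae_notMem _

lemma ae_cos_ne : ∀ᵐ θ ∂(volume : Measure ℝ), cos θ ≠ 0 := by
  have : {θ : ℝ | cos θ = 0} = range fun n : ℤ => (2 * (n : ℝ) + 1) * π / 2 := by
    ext θ
    simp only [mem_ofPred_eq, cos_eq_zero_iff, mem_range]
    exact ⟨fun ⟨k, h⟩ => ⟨k, h.symm⟩, fun ⟨k, h⟩ => ⟨k, h.symm⟩⟩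
  have hc : {θ : ℝ | cos θ = 0}.Countable := by rw [this]; exact countable_range _
  exact hc.ae_notMem _

/-- combined maximal function -/
noncomputable def PP (s s' : ℝ) (f : ℝ → ℝ) (x : ℝ) : ℝ≥0∞ :=
  max (MM (fun y => ENNReal.ofReal |f y| ^ s) x ^ (1 / s))
    (MM (fun y => ENNReal.ofReal |f y| ^ s') x ^ (1 / s'))

lemma S2_le {s s' : ℝ} (hss : s.HolderConjugate s') (hs : 2 < s) :
    ∃ C : ℝ≥0∞, C ≠ ∞ ∧ ∀ f g : ℝ → ℝ, Measurable f → Measurable g → ∀ x,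
      S2 f g x ≤ C * (PP s s' f x * PP s s' g x) := by
  obtain ⟨C, hC, h⟩ := half_bound hss hs
  refine ⟨C + C, by simp [hC], ?_⟩
  intro f g hf hg x
  refine iSup_le fun t => iSup_le fun ht => ?_
  have hF : Measurable fun y => ENNReal.ofReal |f y| := by fun_prop
  have hG : Measurable fun y => ENNReal.ofReal |g y| := by fun_prop
  have h1 := h cos sin measurable_cos measurable_sin cov_cos cov_sin ae_sin_ne _ _ x t hF hG ht
  have h2 := h sin cos measurable_sin measurable_cos cov_sin cov_cos ae_cos_ne _ _ x t hG hF ht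
  have hsub : Ioc 0 (2 * π) ⊆ (Ioc 0 (2 * π) ∩ {θ | 1 ≤ 2 * |cos θ|}) ∪ (Ioc 0 (2 * π) ∩ {θ | 1 ≤ 2 * |sin θ|}) := by
    intro θ hθ
    by_contra hcon
    simp only [mem_union, mem_inter_iff, hθ, true_and, mem_ofPred_eq, not_or, not_le] at hcon
    have := sin_sq_add_cos_sq θ
    rw [← sq_abs (sin θ), ← sq_abs (cos θ)] at this
    nlinarith [abs_nonneg (sin θ), abs_nonneg (cos θ), hcon.1, hcon.2]
  have hinv : (ENNReal.ofReal (2 * π))⁻¹ ≤ 1 := by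
    rw [ENNReal.inv_le_one, ENNReal.one_le_ofReal]
    linarith [pi_gt_three]
  calc _ ≤ 1 * ∫⁻ θ in Ioc (0 : ℝ) (2 * π), ENNReal.ofReal (|f (x - t * cos θ)| * |g (x - t * sin θ)|) := by
        gcongr
    _ = ∫⁻ θ in Ioc (0 : ℝ) (2 * π), ENNReal.ofReal (|f (x - t * cos θ)| * |g (x - t * sin θ)|) := one_mul _
    _ ≤ _ := lintegral_mono_set hsub
    _ ≤ _ := lintegral_union_le _ _ _
    _ ≤ C * (PP s s' f x * PP s s' g x) + C * (PP s s' f x * PP s s' g x) := by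
        refine add_le_add ?_ ?_
        · simp_rw [ENNReal.ofReal_mul (abs_nonneg _)]
          refine h1.trans ?_
          gcongr
          · exact le_max_left _ _
          · exact le_max_right _ _
        · simp_rw [ENNReal.ofReal_mul (abs_nonneg _)]
          simp_rw [mul_comm (ENNReal.ofReal |f _|)]
          refine h2.trans ?_
          rw [mul_comm (PP s s' f x)]
          gcongr
          · exact le_max_left _ _
          · exact le_max_right _ _
    _ = _ := by ring

lemma measurable_PP (s s' : ℝ) (f : ℝ → ℝ) : Measurable (PP s s' f) :=
  ((measurable_MM _).pow_const _).max ((measurable_MM _).pow_const _)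

lemma MM_pow_bound {r q : ℝ} (hr : 0 < r) (hrq : r < q) : ∃ C : ℝ≥0∞, C ≠ ∞ ∧
    ∀ (f : ℝ → ℝ) (B : ℝ), Measurable f → (∀ x, |f x| ≤ B) →
    ∫⁻ x, (MM (fun y => ENNReal.ofReal |f y| ^ r) x ^ (1 / r)) ^ q ≤
      C * ∫⁻ x, ENNReal.ofReal |f x| ^ q := by
  obtain ⟨C, hC, h⟩ := strong_MM ((one_lt_div hr).2 hrq)
  refine ⟨C, hC, fun f B hf hB => ?_⟩
  have := h (fun y => |f y| ^ r) (B ^ r) (by fun_prop) (fun y => by positivity)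
    (fun y => rpow_le_rpow (abs_nonneg _) (hB y) hr.le)
  have e : ∀ y, ENNReal.ofReal (|f y| ^ r) = ENNReal.ofReal |f y| ^ r := fun y =>
    (ENNReal.ofReal_rpow_of_nonneg (abs_nonneg _) hr.le).symm
  simp_rw [e, ← ENNReal.rpow_mul] at this
  simp_rw [← ENNReal.rpow_mul]
  rw [show r * (q / r) = q by field_simp] at this
  rw [show 1 / r * q = q / r by ring]
  exact this

lemma PP_bound {s s' q : ℝ} (hs : 0 < s) (hs' : 0 < s') (hsq : s < q) (hsq' : s' < q) :
    ∃ C : ℝ≥0∞, C ≠ ∞ ∧ ∀ (f : ℝ → ℝ) (B : ℝ), Measurable f → (∀ x, |f x| ≤ B) →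
    (∫⁻ x, PP s s' f x ^ q) ^ (1 / q) ≤ C * eLpNorm f (ENNReal.ofReal q) volume := by
  obtain ⟨C, hC, h⟩ := MM_pow_bound hs hsq
  obtain ⟨C', hC', h'⟩ := MM_pow_bound hs' hsq'
  have hq : 0 < q := hs.trans hsq
  refine ⟨(C + C') ^ (1 / q), ENNReal.rpow_ne_top_of_nonneg (by positivity) (by simp [hC, hC']), ?_⟩
  intro f B hf hB
  have e : eLpNorm f (ENNReal.ofReal q) volume = (∫⁻ x, ENNReal.ofReal |f x| ^ q) ^ (1 / q) := by
    rw [eLpNorm_eq_lintegral_rpow_enorm_toReal (by simpa using hq) ENNReal.ofReal_ne_top, ENNReal.toReal_ofReal hq.le]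
    simp_rw [Real.enorm_eq_ofReal_abs]
  rw [e, ← ENNReal.mul_rpow_of_nonneg _ _ (by positivity)]
  gcongr
  calc ∫⁻ x, PP s s' f x ^ q ≤ ∫⁻ x, ((MM (fun y => ENNReal.ofReal |f y| ^ s) x ^ (1 / s)) ^ q + (MM (fun y => ENNReal.ofReal |f y| ^ s') x ^ (1 / s')) ^ q) := by
        refine lintegral_mono fun x => ?_
        simp only [PP]
        rcases max_choice (MM (fun y => ENNReal.ofReal |f y| ^ s) x ^ (1 / s)) (MM (fun y => ENNReal.ofReal |f y| ^ s') x ^ (1 / s')) with h | h <;> rw [h]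
        · exact le_self_add
        · exact le_add_self
    _ = _ := lintegral_add_left (((measurable_MM _).pow_const _).pow_const _) _
    _ ≤ _ := add_le_add (h f B hf hB) (h' f B hf hB)
    _ = _ := by ring

lemma pos_dir (p₁ p₂ : ℝ) (hp₁ : 2 < p₁) (hp₂ : 2 < p₂) (p : ℝ) (hp : p = p₁ * p₂ / (p₁ + p₂)) :
    ∃ C : ℝ, 0 ≤ C ∧ ∀ f g : SchwartzMap ℝ ℝ,
      lpNorm (ENNReal.ofReal p) (S2 ⇑f ⇑g) ≤
        ENNReal.ofReal C * eLpNorm (⇑f) (ENNReal.ofReal p₁) volume *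
          eLpNorm (⇑g) (ENNReal.ofReal p₂) volume := by
  obtain ⟨s, hs2, hsm⟩ := exists_between (lt_min hp₁ hp₂)
  obtain ⟨hs1, hs2'⟩ := lt_min_iff.1 hsm
  have hss : s.HolderConjugate (Real.conjExponent s) := Real.HolderConjugate.conjExponent (by linarith)
  set s' := Real.conjExponent s
  have hs'0 : 0 < s' := hss.symm.pos
  have hs's : s' < s := by
    have := hss.inv_add_inv_eq_one
    have h1 : s⁻¹ < 2⁻¹ := inv_strictAnti₀ (by norm_num) hs2
    have h2 : (2:ℝ)⁻¹ < s'⁻¹ := by norm_num at *; linarith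
    have := (inv_lt_inv₀ (by norm_num) hs'0).1 h2
    linarith
  obtain ⟨C, hC, hS⟩ := S2_le hss hs2
  obtain ⟨C₁, hC₁, h₁⟩ := PP_bound (by linarith : 0 < s) hs'0 hs1 (by linarith)
  obtain ⟨C₂, hC₂, h₂⟩ := PP_bound (by linarith : 0 < s) hs'0 hs2' (by linarith)
  have hp0 : 0 < p := by rw [hp]; positivity
  have hpp : p < p₁ := by
    rw [hp, div_lt_iff₀ (by linarith)]; nlinarith
  have hpe : 1 / p = 1 / p₁ + 1 / p₂ := by rw [hp]; field_simp; ring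
  refine ⟨(C * (C₁ * C₂)).toReal, ENNReal.toReal_nonneg, fun f g => ?_⟩
  rw [ENNReal.ofReal_toReal (ENNReal.mul_ne_top hC (ENNReal.mul_ne_top hC₁ hC₂))]
  have hfm : Measurable f := f.continuous.measurable
  have hgm : Measurable g := g.continuous.measurable
  have bd : ∀ f : SchwartzMap ℝ ℝ, ∃ B, ∀ x, |f x| ≤ B := by
    intro f
    refine ⟨‖f.toBoundedContinuousFunction‖, fun x => ?_⟩
    have := f.toBoundedContinuousFunction.norm_coe_le_norm x
    simpa using this
  obtain ⟨B, hB⟩ := bd f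
  obtain ⟨B', hB'⟩ := bd g
  rw [_root_.lpNorm, if_neg ENNReal.ofReal_ne_top, ENNReal.toReal_ofReal hp0.le]
  calc (∫⁻ x, S2 f g x ^ p) ^ (1 / p) ≤ (∫⁻ x, (C ^ p) * (PP s s' f * PP s s' g) x ^ p) ^ (1 / p) := by
        gcongr with x
        rw [← ENNReal.mul_rpow_of_nonneg _ _ hp0.le]
        gcongr
        exact hS f g hfm hgm x
    _ = C * (∫⁻ x, (PP s s' f * PP s s' g) x ^ p) ^ (1 / p) := by
        rw [lintegral_const_mul' _ _ (ENNReal.rpow_ne_top_of_nonneg hp0.le hC), ENNReal.mul_rpow_of_nonneg _ _ (by positivity),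
          ← ENNReal.rpow_mul, mul_one_div_cancel hp0.ne', ENNReal.rpow_one]
    _ ≤ C * ((∫⁻ x, PP s s' f x ^ p₁) ^ (1 / p₁) * (∫⁻ x, PP s s' g x ^ p₂) ^ (1 / p₂)) := by
        gcongr
        exact ENNReal.lintegral_Lp_mul_le_Lq_mul_Lr hp0 hpp hpe volume (measurable_PP s s' f).aemeasurable (measurable_PP s s' g).aemeasurable
    _ ≤ C * ((C₁ * eLpNorm f (ENNReal.ofReal p₁) volume) * (C₂ * eLpNorm g (ENNReal.ofReal p₂) volume)) := by
        gcongr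
        · exact h₁ f B hfm hB
        · exact h₂ g B' hgm hB'
    _ = _ := by ring

/-- cutoff -/
noncomputable def chi : ContDiffBump (0 : ℝ) := ⟨2, 3, by norm_num, by norm_num⟩

/-- singular profile -/
noncomputable def fprof (δ y : ℝ) : ℝ := (y ^ 2 + δ ^ 4) ^ (-(1 / 4) : ℝ) * chi y

/-- cutoff as a Schwartz function -/
noncomputable def chiS : SchwartzMap ℝ ℝ := chi.hasCompactSupport.toSchwartzMap chi.contDiff

lemma chiS_apply (y : ℝ) : chiS y = chi y := rfl

lemma fprof_schwartz {δ : ℝ} (hδ : 0 < δ) : ∃ f : SchwartzMap ℝ ℝ, ∀ y, f y = fprof δ y := by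
  have h1 : HasCompactSupport (fprof δ) := chi.hasCompactSupport.mul_left
  have h2 : ContDiff ℝ (⊤ : ℕ∞) (fprof δ) := by
    refine ContDiff.mul (ContDiff.rpow_const_of_ne (by fun_prop) fun x => ?_) chi.contDiff
    positivity
  exact ⟨h1.toSchwartzMap h2, fun y => rfl⟩

lemma fprof_lower {δ x θ : ℝ} (hδ : 0 < δ) (hx : x ∈ Icc (1:ℝ) 2) (hθ : θ ∈ Ioc δ (1 / 2)) :
    θ⁻¹ * (1 / 2) ≤ |fprof δ (x - x * cos θ)| * |chi (x - x * sin θ)| := by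
  have hθ0 : 0 < θ := hδ.trans hθ.1
  have hc : 1 - θ ^ 2 / 2 ≤ cos θ := one_sub_sq_div_two_le_cos
  have hc1 := cos_le_one θ
  have hs0 : 0 ≤ sin θ := sin_nonneg_of_nonneg_of_le_pi hθ0.le (by linarith [hθ.2, pi_gt_three])
  have hs1 := sin_le_one θ
  have hx1 := hx.1
  have hx2 := hx.2
  have hy0 : 0 ≤ x - x * cos θ := by nlinarith
  have hy1 : x - x * cos θ ≤ θ ^ 2 := by nlinarith
  have hθ2 := hθ.2
  have hy2 : x - x * cos θ ≤ 2 := by nlinarith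
  have c1 : chi (x - x * cos θ) = 1 := chi.one_of_mem_closedBall (by
    rw [Metric.mem_closedBall, dist_zero_right, Real.norm_eq_abs, abs_of_nonneg hy0]; exact hy2)
  have c2 : chi (x - x * sin θ) = 1 := chi.one_of_mem_closedBall (by
    rw [Metric.mem_closedBall, dist_zero_right, Real.norm_eq_abs, abs_of_nonneg (by nlinarith)]
    change _ ≤ (2:ℝ)
    nlinarith)
  rw [c2, abs_one, mul_one, fprof, c1, mul_one]
  have hpos : 0 < (x - x * cos θ) ^ 2 + δ ^ 4 := by positivity
  rw [abs_of_pos (by positivity)]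
  have hle : (x - x * cos θ) ^ 2 + δ ^ 4 ≤ (2 * θ) ^ 4 := by
    have a1 : (x - x * cos θ) ^ 2 ≤ (θ ^ 2) ^ 2 := by gcongr
    have a2 : δ ^ 4 ≤ θ ^ 4 := by gcongr; exact hθ.1.le
    nlinarith [pow_pos hθ0 4]
  calc θ⁻¹ * (1 / 2) = ((2 * θ) ^ 4) ^ (-(1 / 4) : ℝ) := by
        rw [← rpow_natCast (2 * θ) 4, ← rpow_mul (by positivity)]
        norm_num
        rw [rpow_neg_one, mul_inv]; ring
    _ ≤ _ := rpow_le_rpow_of_nonpos hpos hle (by norm_num)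

lemma lint_inv {a b : ℝ} (ha : 0 < a) (hab : a ≤ b) :
    ∫⁻ θ in Ioc a b, ENNReal.ofReal (θ⁻¹ * (1 / 2)) = ENNReal.ofReal (Real.log (b / a) * (1 / 2)) := by
  have h0 : ContinuousOn (fun θ : ℝ => θ⁻¹ * (1 / 2)) (uIcc a b) := by
    rw [uIcc_of_le hab]
    intro y hy
    have : y ≠ 0 := (ha.trans_le hy.1).ne'
    exact ContinuousAt.continuousWithinAt (by fun_prop (disch := assumption))
  have hi := h0.intervalIntegrable (μ := volume)
  rw [intervalIntegrable_iff_integrableOn_Ioc_of_le hab] at hi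
  rw [← ofReal_integral_eq_lintegral_ofReal hi]
  · rw [← intervalIntegral.integral_of_le hab, intervalIntegral.integral_mul_const, integral_inv_of_pos ha (ha.trans_le hab)]
  · refine (ae_restrict_iff' measurableSet_Ioc).2 (Filter.Eventually.of_forall fun y hy => ?_)
    have : 0 < y := ha.trans hy.1
    simp only [Pi.zero_apply]; positivity

lemma S2_lower {δ x : ℝ} (hδ : 0 < δ) (hδ1 : δ ≤ 1 / 2) (hx : x ∈ Icc (1:ℝ) 2) :
    (ENNReal.ofReal (2 * π))⁻¹ * ENNReal.ofReal (Real.log (1 / 2 / δ) * (1 / 2)) ≤ S2 (fprof δ) chi x ∧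
    (ENNReal.ofReal (2 * π))⁻¹ * ENNReal.ofReal (Real.log (1 / 2 / δ) * (1 / 2)) ≤ S2 chi (fprof δ) x := by
  have hx0 : 0 < x := by linarith [hx.1]
  have hp := pi_gt_three
  rw [← lint_inv hδ hδ1]
  constructor
  · refine le_iSup_of_le x (le_iSup_of_le hx0 ?_)
    refine mul_le_mul_right ?_ _
    calc _ ≤ ∫⁻ θ in Ioc δ (1 / 2), ENNReal.ofReal (|fprof δ (x - x * cos θ)| * |chi (x - x * sin θ)|) :=
          setLIntegral_mono' measurableSet_Ioc fun θ hθ => ENNReal.ofReal_le_ofReal (fprof_lower hδ hx hθ)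
      _ ≤ _ := lintegral_mono_set (Ioc_subset_Ioc hδ.le (by linarith))
  · refine le_iSup_of_le x (le_iSup_of_le hx0 ?_)
    refine mul_le_mul_right ?_ _
    have h1 := lintegral_image_eq_lintegral_abs_deriv_mul (f := fun v => π / 2 - v) (f' := fun _ => - 1)
      (s := Ioc δ (1 / 2)) measurableSet_Ioc
      (fun v _ => ((hasDerivAt_id v).const_sub (π / 2)).hasDerivWithinAt)
      (fun a _ b _ hab => by simp only at hab; linarith)
      (fun θ => ENNReal.ofReal (|chi (x - x * cos θ)| * |fprof δ (x - x * sin θ)|))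
    simp only [abs_neg, abs_one, ENNReal.ofReal_one, one_mul, cos_pi_div_two_sub, sin_pi_div_two_sub] at h1
    calc _ ≤ ∫⁻ θ in Ioc δ (1 / 2), ENNReal.ofReal (|chi (x - x * sin θ)| * |fprof δ (x - x * cos θ)|) :=
          setLIntegral_mono' measurableSet_Ioc fun θ hθ => ENNReal.ofReal_le_ofReal (by
            rw [mul_comm |chi _|]; exact fprof_lower hδ hx hθ)
      _ = _ := h1.symm
      _ ≤ _ := lintegral_mono_set (by
          rintro _ ⟨v, hv, rfl⟩
          simp only [mem_Ioc] at hv ⊢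
          constructor <;> linarith)

lemma lp_lower {p : ℝ} (hp : 0 < p) (F : ℝ → ℝ≥0∞) (A : ℝ≥0∞) (h : ∀ x ∈ Icc (1:ℝ) 2, A ≤ F x) :
    A ≤ _root_.lpNorm (ENNReal.ofReal p) F := by
  rw [_root_.lpNorm, if_neg ENNReal.ofReal_ne_top, ENNReal.toReal_ofReal hp.le]
  calc A = (∫⁻ x in Icc (1:ℝ) 2, A ^ p) ^ (1 / p) := by
        simp only [lintegral_const, Measure.restrict_apply, MeasurableSet.univ, univ_inter, Real.volume_Icc]
        norm_num
        rw [← ENNReal.rpow_mul, mul_inv_cancel₀ hp.ne', ENNReal.rpow_one]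
    _ ≤ (∫⁻ x in Icc (1:ℝ) 2, F x ^ p) ^ (1 / p) := by
        refine ENNReal.rpow_le_rpow (setLIntegral_mono' measurableSet_Icc fun x hx => ?_) (by positivity)
        exact ENNReal.rpow_le_rpow (h x hx) hp.le
    _ ≤ _ := ENNReal.rpow_le_rpow (setLIntegral_le_lintegral _ _) (by positivity)

lemma lint_add_inv {ε : ℝ} (hε : 0 < ε) (hε1 : ε ≤ 1) :
    ∫⁻ y in Icc (-3 : ℝ) 3, ENNReal.ofReal (1 + 2 * (|y| + ε)⁻¹) ≤
      ENNReal.ofReal (18 - 4 * Real.log ε) := by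
  have hc : Continuous fun y : ℝ => 1 + 2 * (|y| + ε)⁻¹ := by
    refine continuous_const.add (continuous_const.mul (Continuous.inv₀ (by fun_prop) fun y => ?_))
    positivity
  have hi : IntegrableOn (fun y : ℝ => 1 + 2 * (|y| + ε)⁻¹) (Icc (-3) 3) := hc.continuousOn.integrableOn_Icc
  rw [← ofReal_integral_eq_lintegral_ofReal hi (Filter.Eventually.of_forall fun y => by
    simp only [Pi.zero_apply]; positivity)]
  refine ENNReal.ofReal_le_ofReal ?_
  rw [integral_Icc_eq_integral_Ioc, ← intervalIntegral.integral_of_le (by norm_num)]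
  rw [← intervalIntegral.integral_add_adjacent_intervals (b := 0) (hc.intervalIntegrable _ _) (hc.intervalIntegrable _ _)]
  have hlog : Real.log ((3 + ε) / ε) ≤ 3 - Real.log ε := by
    rw [Real.log_div (by positivity) hε.ne']
    have := Real.log_le_sub_one_of_pos (by positivity : 0 < 3 + ε)
    linarith
  have i1 : ∫ y in (0:ℝ)..3, (1 + 2 * (|y| + ε)⁻¹) = 3 + 2 * Real.log ((3 + ε) / ε) := by
    have : ∫ y in (0:ℝ)..3, (1 + 2 * (|y| + ε)⁻¹) = ∫ y in (0:ℝ)..3, (fun z => 1 + 2 * z⁻¹) (y + ε) := by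
      refine intervalIntegral.integral_congr fun y hy => ?_
      rw [uIcc_of_le (by norm_num)] at hy
      simp only [abs_of_nonneg hy.1]
    rw [this, intervalIntegral.integral_comp_add_right (fun z => 1 + 2 * z⁻¹), intervalIntegral.integral_add (by simp) (by
      refine (intervalIntegral.intervalIntegrable_inv (fun z hz => ?_) (by fun_prop)).const_mul 2
      rw [uIcc_of_le (by linarith)] at hz
      linarith [hz.1]), intervalIntegral.integral_const_mul, integral_inv_of_pos (by linarith) (by linarith)]
    simp
  have i2 : ∫ y in (-3:ℝ)..0, (1 + 2 * (|y| + ε)⁻¹) = ∫ y in (0:ℝ)..3, (1 + 2 * (|y| + ε)⁻¹) := by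
    have := intervalIntegral.integral_comp_neg (a := 0) (b := 3) (fun y : ℝ => 1 + 2 * (|y| + ε)⁻¹)
    simp only [abs_neg, neg_zero] at this
    exact this.symm
  rw [i2, i1]
  linarith

lemma fprof_upper {δ q : ℝ} (hδ : 0 < δ) (hδ1 : δ ≤ 1) (hq : 1 < q) (hq2 : q ≤ 2) :
    eLpNorm (fprof δ) (ENNReal.ofReal q) volume ≤ ENNReal.ofReal ((18 - 8 * Real.log δ) ^ (1 / q)) := by
  have hq0 : 0 < q := by linarith
  have hlog : Real.log δ ≤ 0 := Real.log_nonpos hδ.le hδ1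
  rw [eLpNorm_eq_lintegral_rpow_enorm_toReal (by simpa using hq0) ENNReal.ofReal_ne_top, ENNReal.toReal_ofReal hq0.le,
    ← ENNReal.ofReal_rpow_of_nonneg (by linarith) (by positivity)]
  refine ENNReal.rpow_le_rpow ?_ (by positivity)
  simp_rw [Real.enorm_eq_ofReal_abs]
  have hpt : ∀ y, ENNReal.ofReal |fprof δ y| ^ q ≤
      (Icc (-3 : ℝ) 3).indicator (fun y => ENNReal.ofReal (1 + 2 * (|y| + δ ^ 2)⁻¹)) y := by
    intro y
    by_cases hy : y ∈ Icc (-3 : ℝ) 3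
    · rw [indicator_of_mem hy, ENNReal.ofReal_rpow_of_nonneg (abs_nonneg _) hq0.le]
      refine ENNReal.ofReal_le_ofReal ?_
      have hz : 0 < y ^ 2 + δ ^ 4 := by positivity
      have h1 : |fprof δ y| ≤ (y ^ 2 + δ ^ 4) ^ (-(1 / 4) : ℝ) := by
        rw [fprof, abs_mul, abs_of_pos (by positivity), abs_of_nonneg chi.nonneg]
        exact mul_le_of_le_one_right (by positivity) chi.le_one
      have h2 : |fprof δ y| ^ q ≤ (y ^ 2 + δ ^ 4) ^ (-(q / 4) : ℝ) := by
        refine (rpow_le_rpow (abs_nonneg _) h1 hq0.le).trans_eq ?_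
        rw [← rpow_mul hz.le]; congr 1; ring
      refine h2.trans ?_
      rcases le_total 1 (y ^ 2 + δ ^ 4) with h | h
      · have : (y ^ 2 + δ ^ 4) ^ (-(q / 4) : ℝ) ≤ 1 := rpow_le_one_of_one_le_of_nonpos h (by linarith)
        have : 0 ≤ 2 * (|y| + δ ^ 2)⁻¹ := by positivity
        linarith
      · have a1 : (y ^ 2 + δ ^ 4) ^ (-(q / 4) : ℝ) ≤ (y ^ 2 + δ ^ 4) ^ (-(1 / 2) : ℝ) :=
          rpow_le_rpow_of_exponent_ge hz h (by linarith)
        have a2 : ((|y| + δ ^ 2) / 2) ^ 2 ≤ y ^ 2 + δ ^ 4 := by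
          have := sq_abs y
          nlinarith [sq_nonneg (|y| - δ ^ 2), sq_nonneg |y|]
        have a3 : (y ^ 2 + δ ^ 4) ^ (-(1 / 2) : ℝ) ≤ (((|y| + δ ^ 2) / 2) ^ 2) ^ (-(1 / 2) : ℝ) :=
          rpow_le_rpow_of_nonpos (by positivity) a2 (by norm_num)
        have a4 : (((|y| + δ ^ 2) / 2) ^ 2) ^ (-(1 / 2) : ℝ) = 2 * (|y| + δ ^ 2)⁻¹ := by
          rw [← rpow_natCast ((|y| + δ ^ 2) / 2) 2, ← rpow_mul (by positivity)]
          norm_num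
          rw [rpow_neg_one, inv_div]; ring
        linarith
    · rw [indicator_of_notMem hy]
      have : chi y = 0 := chi.zero_of_le_dist (by
        rw [dist_zero_right, Real.norm_eq_abs]
        change (3:ℝ) ≤ |y|
        by_contra hcon
        exact hy (abs_le.1 (not_le.1 hcon).le))
      rw [fprof, this]
      simp [hq0]
  calc _ ≤ _ := lintegral_mono hpt
    _ = _ := lintegral_indicator measurableSet_Icc _
    _ ≤ _ := lint_add_inv (by positivity) (by nlinarith)
    _ = _ := by rw [Real.log_pow]; congr 1; push_cast; ring

lemma no_growth {a c c' K : ℝ} (ha : a < 1) (hc : 0 < c)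
    (h : ∀ L : ℝ, 1 ≤ L → c * L - c' ≤ K * (18 + 8 * L) ^ a) : False := by
  have t1 : Filter.Tendsto (fun L : ℝ => 18 + 8 * L) Filter.atTop Filter.atTop :=
    Filter.tendsto_atTop_add_const_left _ _ (Filter.tendsto_id.const_mul_atTop (by norm_num))
  have t2 : Filter.Tendsto (fun L : ℝ => K * (18 + 8 * L) ^ (-(1 - a)) + (c' + 18 * c / 8) * (18 + 8 * L)⁻¹) Filter.atTop (nhds (K * 0 + (c' + 18 * c / 8) * 0)) :=
    (((tendsto_rpow_neg_atTop (by linarith)).comp t1).const_mul K).add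
      ((tendsto_inv_atTop_zero.comp t1).const_mul _)
  have h3 : c / 8 ≤ K * 0 + (c' + 18 * c / 8) * 0 := by
    refine ge_of_tendsto t2 ?_
    filter_upwards [Filter.eventually_ge_atTop 1] with L hL
    have hp : 0 < 18 + 8 * L := by linarith
    have := h L hL
    have e : (18 + 8 * L) ^ (-(1 - a)) = (18 + 8 * L) ^ a * (18 + 8 * L)⁻¹ := by
      rw [← rpow_neg_one, ← rpow_add hp]; congr 1; ring
    rw [e, ← mul_assoc, ← add_mul, ← div_eq_mul_inv, le_div_iff₀ hp]
    linarith
  simp at h3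
  linarith

lemma neg_core {q p : ℝ} (hq : 1 < q) (hq2 : q ≤ 2) (hp : 0 < p) (K : ℝ≥0∞) (hK : K ≠ ∞)
    (h : ∀ f : SchwartzMap ℝ ℝ, _root_.lpNorm (ENNReal.ofReal p) (S2 f chiS) ≤ K * eLpNorm f (ENNReal.ofReal q) volume ∨
      _root_.lpNorm (ENNReal.ofReal p) (S2 chiS f) ≤ K * eLpNorm f (ENNReal.ofReal q) volume) : False := by
  have hp3 := pi_gt_three
  refine no_growth (a := 1 / q) (c := (2 * π)⁻¹ * (1 / 2)) (c' := (2 * π)⁻¹ * (1 / 2) * Real.log 2) (K := K.toReal)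
    ((div_lt_one (by linarith)).2 hq) (by positivity) fun L hL => ?_
  set δ := Real.exp (-L) with hδ
  have hδ0 : 0 < δ := Real.exp_pos _
  have hlog : Real.log δ = -L := Real.log_exp _
  have hδ1 : δ ≤ 1 / 2 := by
    have h1 : δ ≤ Real.exp (-1) := Real.exp_le_exp.2 (by linarith)
    have h2 : (2:ℝ) ≤ Real.exp 1 := by linarith [Real.add_one_le_exp 1]
    rw [Real.exp_neg] at h1
    refine h1.trans ?_
    rw [one_div]
    exact inv_anti₀ (by norm_num) h2
  obtain ⟨f, hf⟩ := fprof_schwartz hδ0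
  have hf' : (f : ℝ → ℝ) = fprof δ := funext hf
  have hchi : (chiS : ℝ → ℝ) = chi := funext chiS_apply
  have hup := fprof_upper hδ0 (by linarith) hq hq2
  have key : (ENNReal.ofReal (2 * π))⁻¹ * ENNReal.ofReal (Real.log (1 / 2 / δ) * (1 / 2)) ≤ K * eLpNorm (fprof δ) (ENNReal.ofReal q) volume := by
    have := h f
    rw [hf', hchi] at this
    rcases this with h | h
    · exact (lp_lower hp _ _ fun x hx => (S2_lower hδ0 hδ1 hx).1).trans h
    · exact (lp_lower hp _ _ fun x hx => (S2_lower hδ0 hδ1 hx).2).trans h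
  have key2 := key.trans (mul_le_mul_right hup K)
  rw [hlog, ← ENNReal.ofReal_toReal hK, ← ENNReal.ofReal_mul ENNReal.toReal_nonneg, ← ENNReal.ofReal_inv_of_pos (by positivity),
    ← ENNReal.ofReal_mul (by positivity), ENNReal.ofReal_le_ofReal_iff (mul_nonneg ENNReal.toReal_nonneg (rpow_nonneg (by linarith) _)),
    Real.log_div (by norm_num) hδ0.ne', hlog, one_div, Real.log_inv] at key2
  rw [show 18 - 8 * -L = 18 + 8 * L by ring] at key2
  simp only [one_div] at key2 ⊢
  calc _ = _ := by ring
    _ ≤ _ := key2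

lemma chiS_ne_top (q : ℝ) : eLpNorm chiS (ENNReal.ofReal q) volume ≠ ∞ :=
  (chiS.memLp (ENNReal.ofReal q) volume).2.ne

/-- For `p₁, p₂ > 1` and `p = p₁p₂/(p₁+p₂)`, the bilinear spherical maximal
operator satisfies a strong-type `L^{p₁} × L^{p₂} → L^p` bound for Schwartz functions
if and only if `p₁ > 2` and `p₂ > 2`. -/
theorem bilinear_spherical_maximal_strong_bound_iff
    (p₁ p₂ : ℝ) (hp₁ : 1 < p₁) (hp₂ : 1 < p₂) (p : ℝ) (hp : p = p₁ * p₂ / (p₁ + p₂)) :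
    (∃ C : ℝ, 0 ≤ C ∧ ∀ f g : SchwartzMap ℝ ℝ,
      lpNorm (ENNReal.ofReal p) (S2 ⇑f ⇑g) ≤
        ENNReal.ofReal C * eLpNorm (⇑f) (ENNReal.ofReal p₁) volume *
          eLpNorm (⇑g) (ENNReal.ofReal p₂) volume) ↔ (2 < p₁ ∧ 2 < p₂) := by
  have hp0 : 0 < p := by rw [hp]; positivity
  constructor
  · rintro ⟨C, hC, h⟩
    refine ⟨?_, ?_⟩
    · by_contra hcon
      refine neg_core hp₁ (not_lt.1 hcon) hp0 (ENNReal.ofReal C * eLpNorm chiS (ENNReal.ofReal p₂) volume)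
        (ENNReal.mul_ne_top ENNReal.ofReal_ne_top (chiS_ne_top _)) fun f => Or.inl ?_
      refine (h f chiS).trans_eq ?_
      ring
    · by_contra hcon
      exact neg_core hp₂ (not_lt.1 hcon) hp0 (ENNReal.ofReal C * eLpNorm chiS (ENNReal.ofReal p₁) volume)
        (ENNReal.mul_ne_top ENNReal.ofReal_ne_top (chiS_ne_top _)) fun f => Or.inr (h chiS f)
  · rintro ⟨h1, h2⟩
    exact pos_dir p₁ p₂ h1 h2 p hp
end

section
/- Let m ≥ 2 and let p_1,…,p_m ∈ {1,∞} with not all p_i = ∞, and let 1/p = Σ_{i=1}^m 1/p_i. Assume (a) Σ_{i=1}^m 1/p_i < m − 1 and (b) for every i = 1,…,m, Σ_{j≠i} 1/p_j < m − 3/2. Then there exists a finite constant C (depending only on p_1,…,p_m) such that the weak-type bound ‖S^m(f_1,…,f_m)‖_{L^{p,∞}(ℝ)} ≤ C Π_{i=1}^m ‖f_i‖_{L^{p_i}(ℝ)} holds for all Schwartz functions f_1,…,f_m. -/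
open MeasureTheory Real Set
open scoped ENNReal NNReal

lemma weak11 (g : ℝ → ℝ≥0∞) (hg : ∫⁻ x, g x ≠ ∞) (α : ℝ≥0∞) (hα : 0 < α) (hα' : α ≠ ∞) :
    α * volume {x | ∃ t : ℝ, 0 < t ∧ α * ENNReal.ofReal t < ∫⁻ y in Metric.closedBall x (2*t), g y}
      ≤ 16 * ∫⁻ x, g x := by
  set N := ∫⁻ x, g x with hN
  set E := {x | ∃ t : ℝ, 0 < t ∧ α * ENNReal.ofReal t < ∫⁻ y in Metric.closedBall x (2*t), g y} with hE
  choose! T hT0 hT using (fun x (hx : x ∈ E) => hx)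
  have hbd : ∀ x ∈ E, 2 * T x ≤ 2 * (N / α).toReal := by
    intro x hx
    have h1 : α * ENNReal.ofReal (T x) ≤ N := (hT x hx).le.trans (setLIntegral_le_lintegral _ _)
    have h2 : ENNReal.ofReal (T x) ≤ N / α := by
      rw [ENNReal.le_div_iff_mul_le (Or.inl hα.ne') (Or.inl hα'), mul_comm]; exact h1
    have := (ENNReal.ofReal_le_iff_le_toReal (ENNReal.div_lt_top hg hα.ne').ne).1 h2
    linarith
  obtain ⟨u, hu, hdis, hcov⟩ := Vitali.exists_disjoint_subfamily_covering_enlargement_closedBall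
    E (fun x => x) (fun x => 2 * T x) _ hbd 4 (by norm_num)
  have hcount : u.Countable := by
    refine hdis.countable_of_nonempty_interior ?_
    intro x hx
    have := hT0 x (hu hx)
    refine ⟨x, Metric.ball_subset_interior_closedBall (Metric.mem_ball_self (by linarith))⟩
  have hsub : E ⊆ ⋃ x ∈ u, Metric.closedBall x (4 * (2 * T x)) := by
    intro x hx
    obtain ⟨b, hb, hxb⟩ := hcov x hx
    simp only [mem_iUnion]
    refine ⟨b, hb, hxb (Metric.mem_closedBall_self ?_)⟩
    have := hT0 x hx
    linarith
  calc α * volume E ≤ α * ∑' x : u, volume (Metric.closedBall (x:ℝ) (4 * (2 * T x))) := by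
        gcongr
        exact (measure_mono hsub).trans (measure_biUnion_le _ hcount _)
    _ = ∑' x : u, 16 * (α * ENNReal.ofReal (T x)) := by
        rw [← ENNReal.tsum_mul_left]
        congr 1; ext x
        rw [Real.volume_closedBall, show 2 * (4 * (2 * T x)) = 16 * T x by ring,
          ENNReal.ofReal_mul (by norm_num)]
        norm_num; ring
    _ ≤ ∑' x : u, 16 * ∫⁻ y in Metric.closedBall (x:ℝ) (2 * T x), g y := by
        gcongr with x
        exact (hT x (hu x.2)).le
    _ = 16 * ∫⁻ y in ⋃ x ∈ u, Metric.closedBall (x:ℝ) (2 * T x), g y := by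
        rw [ENNReal.tsum_mul_left, lintegral_biUnion hcount (fun x _ => measurableSet_closedBall) hdis]
    _ ≤ 16 * N := by gcongr; exact setLIntegral_le_lintegral _ _

lemma weakHolder {ι : Type*} (K : Finset ι) (hK : K.Nonempty) (F : ι → ℝ → ℝ≥0∞) (N : ι → ℝ≥0∞)
    (hN : ∀ i ∈ K, N i ≠ ∞) (A : ℝ≥0∞) (h0 : ∀ i ∈ K, N i = 0 → ∀ x, F i x = 0)
    (hF : ∀ i ∈ K, ∀ α : ℝ≥0∞, 0 < α → α ≠ ∞ → α * volume {x | α < F i x} ≤ A * N i)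
    (l : ℝ≥0∞) (hl : 0 < l) :
    l * volume {x | l < ∏ i ∈ K, F i x} ^ (K.card : ℝ) ≤ (K.card * A) ^ (K.card : ℝ) * ∏ i ∈ K, N i := by
  have hc : 0 < (K.card : ℝ) := by exact_mod_cast hK.card_pos
  by_cases hl' : l = ∞
  · simp [hl', hK.card_ne_zero]
  by_cases hz : ∃ i ∈ K, N i = 0
  · obtain ⟨i, hi, hiN⟩ := hz
    have : {x | l < ∏ i ∈ K, F i x} = ∅ := by
      ext x
      have h1 : ∏ i ∈ K, F i x = 0 := Finset.prod_eq_zero hi (h0 i hi hiN x)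
      simp [h1]
    simp [this, hK.card_ne_zero]
  push Not at hz
  set B := ∏ i ∈ K, N i with hB
  have hB0 : B ≠ 0 := Finset.prod_ne_zero_iff.2 hz
  have hBt : B ≠ ∞ := ENNReal.prod_ne_top hN
  set θ := (l / B) ^ (1 / (K.card : ℝ)) with hθ
  have hlB0 : l / B ≠ 0 := ENNReal.div_ne_zero.2 ⟨hl.ne', hBt⟩
  have hlBt : l / B ≠ ∞ := ENNReal.div_ne_top hl' hB0
  have hθ0 : θ ≠ 0 := by simp [hθ, hlB0, hlBt]
  have hθt : θ ≠ ∞ := ENNReal.rpow_ne_top_of_nonneg (by positivity) hlBt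
  have hθk : θ ^ (K.card : ℝ) = l / B := by
    rw [hθ, ← ENNReal.rpow_mul, one_div_mul_cancel hc.ne', ENNReal.rpow_one]
  have hsub : {x | l < ∏ i ∈ K, F i x} ⊆ ⋃ i ∈ K, {x | θ * N i < F i x} := by
    intro x hx
    by_contra hcon
    simp only [mem_iUnion, mem_ofPred_eq, not_exists, not_lt] at hcon
    have : ∏ i ∈ K, F i x ≤ ∏ i ∈ K, (θ * N i) := Finset.prod_le_prod' hcon
    rw [Finset.prod_mul_distrib, Finset.prod_const, ← ENNReal.rpow_natCast, hθk,
      ENNReal.div_mul_cancel hB0 hBt] at this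
    exact absurd hx (not_lt.2 this)
  have hv : θ * volume {x | l < ∏ i ∈ K, F i x} ≤ K.card * A := by
    calc _ ≤ θ * ∑ i ∈ K, volume {x | θ * N i < F i x} := by
          gcongr
          exact (measure_mono hsub).trans (measure_biUnion_finset_le _ _)
      _ = ∑ i ∈ K, θ * volume {x | θ * N i < F i x} := by rw [Finset.mul_sum]
      _ ≤ ∑ i ∈ K, A := by
          refine Finset.sum_le_sum fun i hi => ?_
          have := hF i hi (θ * N i) (pos_iff_ne_zero.2 (mul_ne_zero hθ0 (hz i hi)))
            (ENNReal.mul_ne_top hθt (hN i hi))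
          rw [mul_right_comm] at this
          exact (ENNReal.mul_le_mul_iff_left (hz i hi) (hN i hi)).1 this
      _ = _ := by simp
  have h2 := ENNReal.rpow_le_rpow hv hc.le
  rw [ENNReal.mul_rpow_of_nonneg _ _ hc.le, hθk] at h2
  calc _ = (l / B * volume {x | l < ∏ i ∈ K, F i x} ^ (K.card:ℝ)) * B := by
        rw [mul_right_comm, ENNReal.div_mul_cancel hB0 hBt]
    _ ≤ _ := by gcongr

lemma sphere_le (m : ℕ) (G : EuclideanSpace ℝ (Fin m) → ℝ) (hG : Continuous G) (hG0 : ∀ x, 0 ≤ G x)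
    (I : ℝ≥0∞)
    (h : ∀ ε : ℝ, 0 < ε → ε ≤ 1 →
      ∫⁻ x in {x | 1 < ‖x‖ ∧ ‖x‖ < 1 + ε}, ENNReal.ofReal (G x) ≤ ENNReal.ofReal ε * I) :
    ∫⁻ y : Metric.sphere (0 : EuclideanSpace ℝ (Fin m)) 1, ENNReal.ofReal (G y)
      ∂((volume : Measure (EuclideanSpace ℝ (Fin m))).toSphere) ≤ I := by
  set μ := (volume : Measure (EuclideanSpace ℝ (Fin m))).toSphere with hμ
  set A : ℝ → ℝ := fun r => ∫ y in univ, G (r • (y : EuclideanSpace ℝ (Fin m))) ∂μ with hA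
  have hcont : Continuous A := by
    apply continuous_parametric_integral_of_continuous _ isCompact_univ
    have : Continuous (fun q : ℝ × Metric.sphere (0 : EuclideanSpace ℝ (Fin m)) 1 =>
      q.1 • (q.2 : EuclideanSpace ℝ (Fin m))) := by fun_prop
    exact hG.comp this
  have hAr : ∀ r, ENNReal.ofReal (A r) = ∫⁻ y, ENNReal.ofReal (G (r • (y : EuclideanSpace ℝ (Fin m)))) ∂μ := by
    intro r
    have hc : Continuous (fun y : Metric.sphere (0 : EuclideanSpace ℝ (Fin m)) 1 => G (r • (y : EuclideanSpace ℝ (Fin m)))) := by fun_prop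
    simp only [hA, Measure.restrict_univ]
    rw [ofReal_integral_eq_lintegral_ofReal]
    · exact hc.integrable_of_hasCompactSupport (HasCompactSupport.of_compactSpace _)
    · exact Filter.Eventually.of_forall fun y => hG0 _
  by_contra hcon
  push Not at hcon
  obtain ⟨c, hc1, hc2⟩ := exists_between hcon
  have hA1 : c < ENNReal.ofReal (A 1) := by rw [hAr]; simpa using hc2
  have hev : ∀ᶠ r in nhds (1:ℝ), c < ENNReal.ofReal (A r) :=
    (ENNReal.continuous_ofReal.comp hcont).continuousAt.eventually (lt_mem_nhds hA1)
  obtain ⟨ε, hε, hball⟩ := Metric.eventually_nhds_iff.1 hev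
  set e := min ε 1 with he
  have he0 : 0 < e := lt_min hε one_pos
  have key : c * ENNReal.ofReal e ≤ ENNReal.ofReal e * I := by
    refine le_trans ?_ (h e he0 (min_le_right _ _))
    set S : Set (EuclideanSpace ℝ (Fin m)) := {x | 1 < ‖x‖ ∧ ‖x‖ < 1 + e} with hS
    have hSm : MeasurableSet S :=
      (measurableSet_lt measurable_const measurable_norm).inter
        (measurableSet_lt measurable_norm measurable_const)
    have hind : Measurable (S.indicator fun x => ENNReal.ofReal (G x)) :=
      (hG.measurable.ennreal_ofReal).indicator hSm
    have e1 : ∫⁻ x in S, ENNReal.ofReal (G x) = ∫⁻ q : Metric.sphere (0 : EuclideanSpace ℝ (Fin m)) 1 × Ioi (0:ℝ),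
        S.indicator (fun x => ENNReal.ofReal (G x)) (q.2.1 • q.1.1)
        ∂(μ.prod (Measure.volumeIoiPow (Module.finrank ℝ (EuclideanSpace ℝ (Fin m)) - 1))) := by
      have hmp := (volume : Measure (EuclideanSpace ℝ (Fin m))).measurePreserving_homeomorphUnitSphereProd
      rw [← hmp.lintegral_comp_emb (Homeomorph.measurableEmbedding _)]
      rw [← lintegral_indicator hSm]
      have : ∀ x : ({0}ᶜ : Set (EuclideanSpace ℝ (Fin m))),
        ((homeomorphUnitSphereProd (EuclideanSpace ℝ (Fin m)) x).2.1 • (homeomorphUnitSphereProd (EuclideanSpace ℝ (Fin m)) x).1.1) = x.1 := by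
        intro x
        have hx : ‖x.1‖ ≠ 0 := norm_ne_zero_iff.2 x.2
        simp [smul_smul, hx]
      simp only [this]
      rw [lintegral_subtype_comap (measurableSet_singleton _).compl (S.indicator fun x => ENNReal.ofReal (G x))]
      rw [← lintegral_indicator (measurableSet_singleton _).compl]
      congr 1
      ext x
      by_cases hx : x = 0
      · simp [hx, hS]
      · simp [hx]
    rw [e1, lintegral_prod_symm']
    swap
    · apply hind.comp
      fun_prop
    set ν := Measure.volumeIoiPow (Module.finrank ℝ (EuclideanSpace ℝ (Fin m)) - 1) with hν
    set J : Set (Ioi (0:ℝ)) := Subtype.val ⁻¹' (Ioo 1 (1+e)) with hJ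
    have hJm : MeasurableSet J := measurable_subtype_coe measurableSet_Ioo
    have hJv : ENNReal.ofReal e ≤ ν J := by
      rw [hν, Measure.volumeIoiPow, withDensity_apply _ hJm]
      calc ENNReal.ofReal e = volume (Ioo (1:ℝ) (1+e)) := by simp
        _ = (Measure.comap Subtype.val volume) J := by
            rw [comap_subtype_coe_apply measurableSet_Ioi, hJ, Subtype.image_preimage_coe]
            congr 1
            ext r; simp; intro h1 _; linarith
        _ = ∫⁻ r in J, 1 ∂(Measure.comap Subtype.val volume) := by simp
        _ ≤ _ := by
            apply setLIntegral_mono' hJm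
            intro r hr
            rw [← ENNReal.ofReal_one]
            apply ENNReal.ofReal_le_ofReal
            exact one_le_pow₀ (le_of_lt hr.1)
    calc c * ENNReal.ofReal e ≤ c * ν J := by gcongr
      _ = ∫⁻ r in J, c ∂ν := by simp
      _ ≤ ∫⁻ r in J, ∫⁻ y, S.indicator (fun x => ENNReal.ofReal (G x)) (r.1 • y.1) ∂μ ∂ν := by
          apply setLIntegral_mono' hJm
          intro r hr
          have hr' : dist r.1 1 < ε := by
            rw [Real.dist_eq, abs_of_pos (by linarith [hr.1])]
            have := hr.2
            have : e ≤ ε := min_le_left _ _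
            linarith [hr.2]
          have h3 := (hball hr').le
          rw [hAr] at h3
          refine h3.trans (le_of_eq ?_)
          congr 1
          ext y
          rw [indicator_of_mem]
          have : ‖r.1 • y.1‖ = r.1 := by
            rw [norm_smul, Real.norm_of_nonneg (le_of_lt r.2)]
            simp
          simp only [hS, mem_ofPred_eq, this]
          exact hr
      _ ≤ _ := setLIntegral_le_lintegral _ _
  rw [mul_comm] at key
  exact absurd ((ENNReal.mul_le_mul_iff_right (by simpa using he0) ENNReal.ofReal_ne_top).1 key) (not_le.2 hc1)

lemma annulus_le {ι : Type*} [Fintype ι] (hι : Fintype.card ι = 2) (s d : ℝ) (hd : 0 ≤ d) :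
    volume {v : ι → ℝ | s < ∑ i, v i ^ 2 ∧ ∑ i, v i ^ 2 < s + d} ≤ ENNReal.ofReal (π * d) := by
  have hm : MeasurableSet {v : ι → ℝ | s < ∑ i, v i ^ 2 ∧ ∑ i, v i ^ 2 < s + d} := by
    have : Measurable (fun v : ι → ℝ => ∑ i, v i ^ 2) := by fun_prop
    exact (measurableSet_lt measurable_const this).inter (measurableSet_lt this measurable_const)
  rw [← (PiLp.volume_preserving_ofLp ι).measure_preimage hm.nullMeasurableSet]
  have hset : (@WithLp.ofLp 2 (ι → ℝ)) ⁻¹' {v : ι → ℝ | s < ∑ i, v i ^ 2 ∧ ∑ i, v i ^ 2 < s + d}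
      = {x : EuclideanSpace ℝ ι | s < ‖x‖^2 ∧ ‖x‖^2 < s + d} := by
    ext x
    simp [EuclideanSpace.norm_sq_eq]
  rw [hset]
  have : Nonempty ι := Fintype.card_pos_iff.1 (by omega)
  have hb : ∀ r : ℝ, 0 ≤ r → volume (Metric.ball (0 : EuclideanSpace ℝ ι) (√r)) = ENNReal.ofReal (π * r) := by
    intro r hr
    rw [EuclideanSpace.volume_ball, hι, ← ENNReal.ofReal_pow (Real.sqrt_nonneg _), Real.sq_sqrt hr,
      Real.sq_sqrt Real.pi_pos.le, ← ENNReal.ofReal_mul hr]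
    norm_num [mul_comm]
  by_cases h1 : s + d ≤ 0
  · have : {x : EuclideanSpace ℝ ι | s < ‖x‖^2 ∧ ‖x‖^2 < s + d} = ∅ := by
      ext x; simp only [mem_ofPred_eq, mem_empty_iff_false, iff_false, not_and, not_lt]
      intro _; nlinarith [sq_nonneg ‖x‖]
    simp [this]
  push Not at h1
  have hsubb : {x : EuclideanSpace ℝ ι | s < ‖x‖^2 ∧ ‖x‖^2 < s + d} ⊆ Metric.ball 0 (√(s+d)) := by
    intro x hx
    rw [mem_ball_zero_iff]
    exact Real.lt_sqrt_of_sq_lt hx.2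
  by_cases h2 : s < 0
  · refine (measure_mono hsubb).trans ?_
    rw [hb _ h1.le]
    apply ENNReal.ofReal_le_ofReal
    have := Real.pi_pos
    nlinarith
  push Not at h2
  have hsub2 : {x : EuclideanSpace ℝ ι | s < ‖x‖^2 ∧ ‖x‖^2 < s + d} ⊆ Metric.ball 0 (√(s+d)) \ Metric.ball 0 (√s) := by
    intro x hx
    refine ⟨hsubb hx, ?_⟩
    rw [mem_ball_zero_iff, not_lt]
    exact Real.sqrt_le_iff.2 ⟨norm_nonneg _, hx.1.le⟩
  refine (measure_mono hsub2).trans ?_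
  rw [measure_sdiff (Metric.ball_subset_ball (Real.sqrt_le_sqrt (by linarith))) measurableSet_ball.nullMeasurableSet
    (by rw [hb _ h2]; exact ENNReal.ofReal_ne_top), hb _ h1.le, hb _ h2, ← ENNReal.ofReal_sub _ (by positivity)]
  apply ENNReal.ofReal_le_ofReal
  linarith

lemma shell_le (m : ℕ) (a b : Fin m) (hab : a ≠ b) (h : Fin m → ℝ → ℝ) (hc : ∀ i, Continuous (h i))
    (h0 : ∀ i x, 0 ≤ h i x) (ε : ℝ) (hε : 0 < ε) (hε1 : ε ≤ 1) :
    ∫⁻ x : EuclideanSpace ℝ (Fin m) in {x | 1 < ‖x‖ ∧ ‖x‖ < 1 + ε},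
      ENNReal.ofReal (∏ i : {i // ¬ (i = a ∨ i = b)}, h i (x i)) ≤
    ENNReal.ofReal ε * (ENNReal.ofReal (3 * π) *
      ∏ i : {i // ¬ (i = a ∨ i = b)}, ∫⁻ y in Icc (-2:ℝ) 2, ENNReal.ofReal (h i y)) := by
  set p : Fin m → Prop := fun i => i = a ∨ i = b with hp
  have hcard : Fintype.card {i // p i} = 2 := by
    rw [Fintype.card_subtype, show ({x | p x} : Finset (Fin m)) = {a, b} by ext; simp [hp]]
    exact Finset.card_pair hab
  set S : Set (EuclideanSpace ℝ (Fin m)) := {x | 1 < ‖x‖ ∧ ‖x‖ < 1 + ε} with hS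
  have hSm : MeasurableSet S :=
    (measurableSet_lt measurable_const measurable_norm).inter
      (measurableSet_lt measurable_norm measurable_const)
  set g : {i // ¬ p i} → ℝ → ℝ := fun i => (Icc (-2:ℝ) 2).indicator (h i) with hg
  have hgm : ∀ i, Measurable (g i) := fun i => (hc i).measurable.indicator measurableSet_Icc
  have hgi : ∀ i, Integrable (g i) := fun i =>
    ((hc i).continuousOn.integrableOn_compact isCompact_Icc).integrable_indicator measurableSet_Icc
  have hg0 : ∀ i x, 0 ≤ g i x := fun i x => indicator_nonneg (fun y _ => h0 i y) x
  -- annulus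
  set T : Set (({i // p i} → ℝ) × ({i // ¬ p i} → ℝ)) :=
    {q | (1 - ∑ i, q.2 i ^ 2) < ∑ i, q.1 i ^ 2 ∧ ∑ i, q.1 i ^ 2 < (1 - ∑ i, q.2 i ^ 2) + 3 * ε} with hT
  have hTm : MeasurableSet T := by
    have m1 : Measurable (fun q : ({i // p i} → ℝ) × ({i // ¬ p i} → ℝ) => ∑ i, q.1 i ^ 2) := by fun_prop
    have m2 : Measurable (fun q : ({i // p i} → ℝ) × ({i // ¬ p i} → ℝ) => 1 - ∑ i, q.2 i ^ 2) := by fun_prop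
    exact (measurableSet_lt m2 m1).inter (measurableSet_lt m1 (m2.add_const _))
  set Φ : ({i // p i} → ℝ) × ({i // ¬ p i} → ℝ) → ℝ≥0∞ :=
    T.indicator (fun q => ENNReal.ofReal (∏ i, g i (q.2 i))) with hΦ
  have hgp : Measurable (fun u : {i // ¬ p i} → ℝ => ∏ i, g i (u i)) := by
    apply Finset.measurable_fun_prod
    intro i _
    exact (hgm i).comp (measurable_pi_apply i)
  have hΦm : Measurable Φ :=
    ((hgp.comp measurable_snd).ennreal_ofReal).indicator hTm
  have step1 : ∫⁻ x in S, ENNReal.ofReal (∏ i : {i // ¬ p i}, h i (x i)) ≤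
      ∫⁻ x : EuclideanSpace ℝ (Fin m), Φ (MeasurableEquiv.piEquivPiSubtypeProd (fun _ => ℝ) p (WithLp.ofLp x)) := by
    rw [← lintegral_indicator hSm]
    apply lintegral_mono
    intro x
    by_cases hx : x ∈ S
    · rw [indicator_of_mem hx]
      have hn : ‖x‖ ^ 2 = ∑ i : {i // p i}, x i ^ 2 + ∑ i : {i // ¬ p i}, x i ^ 2 := by
        rw [EuclideanSpace.norm_sq_eq, ← Fintype.sum_subtype_add_sum_subtype p]
        simp
      have hxT : MeasurableEquiv.piEquivPiSubtypeProd (fun _ => ℝ) p (WithLp.ofLp x) ∈ T := by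
        have h1 := hx.1
        have h2 := hx.2
        simp only [hT, mem_ofPred_eq, MeasurableEquiv.piEquivPiSubtypeProd_apply]
        constructor
        · nlinarith
        · nlinarith
      simp only [hΦ]
      rw [indicator_of_mem hxT]
      apply ENNReal.ofReal_le_ofReal
      apply le_of_eq
      apply Finset.prod_congr rfl
      intro i _
      simp only [hg, MeasurableEquiv.piEquivPiSubtypeProd_apply]
      rw [indicator_of_mem]
      have h3 : |x i| ≤ ‖x‖ := by simpa using PiLp.norm_apply_le x i.1
      exact abs_le.1 (h3.trans (by linarith [hx.2]))
    · rw [indicator_of_notMem hx]; exact zero_le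
  refine step1.trans ?_
  have mp1 := PiLp.volume_preserving_ofLp (Fin m)
  have mp2 := volume_preserving_piEquivPiSubtypeProd (fun _ : Fin m => ℝ) p
  rw [mp1.lintegral_comp (f := fun x => Φ (MeasurableEquiv.piEquivPiSubtypeProd (fun _ => ℝ) p x))
    (hΦm.comp (MeasurableEquiv.measurable _)), mp2.lintegral_comp hΦm, Measure.volume_eq_prod, lintegral_prod_symm' _ hΦm]
  have hlast : ∫⁻ u : {i // ¬ p i} → ℝ, ENNReal.ofReal (∏ i, g i (u i)) =
      ∏ i : {i // ¬ p i}, ∫⁻ y in Icc (-2:ℝ) 2, ENNReal.ofReal (h i y) := by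
    have hint : Integrable (fun u : {i // ¬ p i} → ℝ => ∏ i, g i (u i)) volume :=
      Integrable.fintype_prod hgi
    rw [← ofReal_integral_eq_lintegral_ofReal hint
      (Filter.Eventually.of_forall fun u => Finset.prod_nonneg fun i _ => hg0 i _),
      integral_fintype_prod_volume_eq_prod,
      ENNReal.ofReal_prod_of_nonneg (fun i _ => integral_nonneg (hg0 i))]
    apply Finset.prod_congr rfl
    intro i _
    rw [ofReal_integral_eq_lintegral_ofReal (hgi i) (Filter.Eventually.of_forall (hg0 i)),
      ← lintegral_indicator measurableSet_Icc]
    congr 1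
    ext y
    by_cases hy : y ∈ Icc (-2:ℝ) 2
    · simp only [hg, indicator_of_mem hy]
    · simp only [hg, indicator_of_notMem hy, ENNReal.ofReal_zero]
  calc ∫⁻ u, ∫⁻ v, Φ (v, u) ≤ ∫⁻ u : {i // ¬ p i} → ℝ, ENNReal.ofReal (∏ i, g i (u i)) * ENNReal.ofReal (π * (3 * ε)) := by
        apply lintegral_mono
        intro u
        have e1 : ∀ v, Φ (v, u) = {v : {i // p i} → ℝ | (1 - ∑ i, u i ^ 2) < ∑ i, v i ^ 2 ∧
            ∑ i, v i ^ 2 < (1 - ∑ i, u i ^ 2) + 3 * ε}.indicator (fun _ => ENNReal.ofReal (∏ i, g i (u i))) v := by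
          intro v; rfl
        simp only [e1]
        refine (lintegral_indicator_const_le _ _).trans ?_
        gcongr
        exact annulus_le hcard _ _ (by positivity)
    _ = _ := by
        rw [lintegral_mul_const _ hgp.ennreal_ofReal, hlast,
          show π * (3 * ε) = ε * (3 * π) by ring, ENNReal.ofReal_mul hε.le]
        ring

lemma cov (f : ℝ → ℝ) (hf : Continuous f) (x t : ℝ) (ht : 0 < t) :
    ENNReal.ofReal t * ∫⁻ y in Icc (-2:ℝ) 2, ENNReal.ofReal |f (x - t * y)| =
      ∫⁻ y in Metric.closedBall x (2 * t), ENNReal.ofReal |f y| := by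
  have key : ∀ (g : ℝ → ℝ), Continuous g → (∀ y, 0 ≤ g y) → ∀ u v : ℝ, u ≤ v →
      ∫⁻ y in Icc u v, ENNReal.ofReal (g y) = ENNReal.ofReal (∫ y in u..v, g y) := by
    intro g hg hg0 u v huv
    rw [intervalIntegral.integral_of_le huv, ← integral_Icc_eq_integral_Ioc,
      ofReal_integral_eq_lintegral_ofReal (hg.continuousOn.integrableOn_compact isCompact_Icc)
        (Filter.Eventually.of_forall hg0)]
  rw [Real.closedBall_eq_Icc, key (fun y => |f (x - t * y)|) (by fun_prop) (fun y => abs_nonneg _) _ _ (by norm_num),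
    key (fun y => |f y|) (by fun_prop) (fun y => abs_nonneg _) _ _ (by linarith),
    ← ENNReal.ofReal_mul ht.le, intervalIntegral.integral_comp_sub_mul (fun y => |f y|) ht.ne', smul_eq_mul,
    mul_inv_cancel_left₀ ht.ne']
  congr 3 <;> ring

/-- one-dimensional maximal function -/
noncomputable def HLF (f : ℝ → ℝ) (x : ℝ) : ℝ≥0∞ :=
  ⨆ (t : ℝ) (_ : 0 < t), ∫⁻ y in Icc (-2:ℝ) 2, ENNReal.ofReal |f (x - t * y)|

lemma eLpNorm_one_eq (f : ℝ → ℝ) : eLpNorm f 1 volume = ∫⁻ x, ENNReal.ofReal |f x| := by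
  rw [eLpNorm_one_eq_lintegral_enorm]
  simp [Real.enorm_eq_ofReal_abs]

lemma schw_ne_top (f : SchwartzMap ℝ ℝ) (q : ℝ≥0∞) : eLpNorm f q volume ≠ ∞ :=
  (f.memLp q volume).eLpNorm_ne_top

lemma HLF_weak (f : SchwartzMap ℝ ℝ) (α : ℝ≥0∞) (hα : 0 < α) (hα' : α ≠ ∞) :
    α * volume {x | α < HLF f x} ≤ 16 * eLpNorm f 1 volume := by
  have hN : eLpNorm f 1 volume ≠ ∞ := schw_ne_top f 1
  rw [eLpNorm_one_eq] at hN ⊢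
  refine le_trans ?_ (weak11 (fun x => ENNReal.ofReal |f x|) hN α hα hα')
  refine mul_le_mul_right (measure_mono ?_) _
  intro x hx
  simp only [mem_ofPred_eq, HLF, lt_iSup_iff] at hx
  obtain ⟨t, ht, hx⟩ := hx
  refine ⟨t, ht, ?_⟩
  rw [← cov f f.continuous x t ht, mul_comm]
  exact ENNReal.mul_lt_mul_right (by simpa using ht) ENNReal.ofReal_ne_top hx

lemma HLF_zero (f : SchwartzMap ℝ ℝ) (h : eLpNorm f 1 volume = 0) (x : ℝ) : HLF f x = 0 := by
  have h1 : (f : ℝ → ℝ) =ᵐ[volume] 0 :=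
    (eLpNorm_eq_zero_iff f.continuous.aestronglyMeasurable one_ne_zero).1 h
  have h2 : (f : ℝ → ℝ) = 0 := (Continuous.ae_eq_iff_eq volume f.continuous continuous_zero).1 h1
  simp [HLF, h2]

lemma schw_sup_le (f : SchwartzMap ℝ ℝ) (x : ℝ) : ENNReal.ofReal |f x| ≤ eLpNorm f ∞ volume := by
  have h1 : ∀ᵐ y, ‖f y‖ₑ ≤ eLpNorm f ∞ volume := by
    rw [eLpNorm_exponent_top]; exact ae_le_eLpNormEssSup
  have ho : IsOpen {y | eLpNorm f ∞ volume < ‖f y‖ₑ} :=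
    isOpen_lt continuous_const f.continuous.enorm
  have h2 : {y | eLpNorm f ∞ volume < ‖f y‖ₑ} = ∅ := by
    rw [← ho.measure_eq_zero_iff volume]
    simpa [ae_iff] using h1
  by_contra hc
  push Not at hc
  rw [← Real.enorm_eq_ofReal_abs] at hc
  have : x ∈ {y | eLpNorm f ∞ volume < ‖f y‖ₑ} := hc
  rw [h2] at this
  exact this

lemma sphAvg_le (m : ℕ) (a b : Fin m) (hab : a ≠ b) (K : Finset (Fin m)) (ha : a ∉ K) (hb : b ∉ K)
    (f : Fin m → SchwartzMap ℝ ℝ) (t x : ℝ) (ht : 0 < t) :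
    sphAvg m (fun i => ⇑(f i)) t x ≤
      ((volume : Measure (EuclideanSpace ℝ (Fin m))).toSphere Set.univ)⁻¹ * (ENNReal.ofReal (3 * π) *
        ∏ i, if i ∈ K then HLF (f i) x else 4 * eLpNorm (f i) ∞ volume) := by
  have hM : ∀ i, eLpNorm (f i) ∞ volume ≠ ∞ := fun i => schw_ne_top (f i) ∞
  rw [sphAvg, sphMeasure, lintegral_smul_measure, smul_eq_mul]
  gcongr
  set w : Fin m → ℝ≥0∞ := fun i => if i ∈ K then HLF (f i) x else 4 * eLpNorm (f i) ∞ volume with hw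
  set h : Fin m → ℝ → ℝ := fun i y => if i ∈ K then |f i (x - t * y)| else (eLpNorm (f i) ∞ volume).toReal with hh
  have hc : ∀ i, Continuous (h i) := by
    intro i
    have := (f i).continuous
    by_cases hi : i ∈ K
    · simp only [hh, hi, if_true]; fun_prop
    · simp only [hh, hi, if_false]; fun_prop
  have h0 : ∀ i y, 0 ≤ h i y := by
    intro i y
    simp only [hh]; split_ifs <;> positivity
  have hfh : ∀ i y, ENNReal.ofReal |f i (x - t * y)| ≤ ENNReal.ofReal (h i y) := by
    intro i y
    simp only [hh]; split_ifs
    · exact le_rfl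
    · rw [ENNReal.ofReal_toReal (hM i)]; exact schw_sup_le _ _
  have hpw : ∀ i, (i = a ∨ i = b) → ∀ y, ENNReal.ofReal |f i (x - t * y)| ≤ w i := by
    intro i hi y
    have hiK : i ∉ K := by rcases hi with rfl | rfl <;> assumption
    simp only [hw, hiK, if_false]
    refine (schw_sup_le _ _).trans ?_
    nth_rw 1 [← one_mul (eLpNorm _ _ _)]
    gcongr
    norm_num
  have hint : ∀ i, ∫⁻ y in Icc (-2:ℝ) 2, ENNReal.ofReal (h i y) ≤ w i := by
    intro i
    by_cases hi : i ∈ K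
    · simp only [hh, hw, hi, if_true, HLF]
      exact le_iSup₂ (f := fun (t : ℝ) (_ : 0 < t) => ∫⁻ y in Icc (-2:ℝ) 2, ENNReal.ofReal |f i (x - t * y)|) t ht
    · simp only [hh, hw, hi, if_false]
      rw [ENNReal.ofReal_toReal (hM i), lintegral_const]
      simp [mul_comm]
      norm_num
  have hsph := sphere_le m (fun z => ∏ i : {i // ¬ (i = a ∨ i = b)}, h i (z i))
    (by
      apply continuous_finsetProd
      intro i _
      exact (hc i).comp (by fun_prop))
    (fun z => Finset.prod_nonneg fun i _ => h0 _ _) _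
    (fun ε hε hε1 => shell_le m a b hab h hc h0 ε hε hε1)
  calc _ ≤ ∫⁻ y : Metric.sphere (0 : EuclideanSpace ℝ (Fin m)) 1,
        (∏ i : {i // i = a ∨ i = b}, w i) * ENNReal.ofReal (∏ i : {i // ¬ (i = a ∨ i = b)}, h i (y.1 i))
        ∂((volume : Measure (EuclideanSpace ℝ (Fin m))).toSphere) := by
        apply lintegral_mono
        intro y
        dsimp only
        rw [← Fintype.prod_subtype_mul_prod_subtype (fun i => i = a ∨ i = b),
          ENNReal.ofReal_prod_of_nonneg (fun i _ => h0 _ _)]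
        exact mul_le_mul' (Finset.prod_le_prod' fun i _ => hpw i i.2 _)
          (Finset.prod_le_prod' fun i _ => hfh i _)
    _ = (∏ i : {i // i = a ∨ i = b}, w i) * ∫⁻ y : Metric.sphere (0 : EuclideanSpace ℝ (Fin m)) 1,
        ENNReal.ofReal (∏ i : {i // ¬ (i = a ∨ i = b)}, h i (y.1 i))
        ∂((volume : Measure (EuclideanSpace ℝ (Fin m))).toSphere) := by
        rw [lintegral_const_mul]
        apply Measurable.ennreal_ofReal
        apply Finset.measurable_fun_prod
        intro i _
        exact (hc i).measurable.comp (by fun_prop)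
    _ ≤ (∏ i : {i // i = a ∨ i = b}, w i) * (ENNReal.ofReal (3 * π) *
        ∏ i : {i // ¬ (i = a ∨ i = b)}, w i) := by
        refine mul_le_mul_right (hsph.trans ?_) _
        gcongr with i _
        exact hint i
    _ = _ := by
        rw [← Fintype.prod_subtype_mul_prod_subtype (fun i => i = a ∨ i = b) w]
        ring

/-- If each `pᵢ ∈ {1,∞}`, not all `pᵢ = ∞`, `1/p = Σ 1/pᵢ`, and conditions
(a) `Σ 1/pᵢ < m-1` and (b) `Σ_{j≠i} 1/pⱼ < m-3/2` for all `i` hold, then the weak-type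
bound `‖S^m(f₁,…,f_m)‖_{L^{p,∞}} ≤ C ∏ ‖fᵢ‖_{L^{pᵢ}}` holds for Schwartz functions. -/
theorem multilinear_spherical_maximal_weak_bound
    (m : ℕ) (hm : 2 ≤ m) (p : Fin m → ℝ≥0∞)
    (hp : ∀ i, p i = 1 ∨ p i = ∞) (hone : ∃ i, p i = 1)
    (ha : ∑ i, (p i)⁻¹ < (m : ℝ≥0∞) - 1)
    (hb : ∀ i, ∑ j ∈ Finset.univ.erase i, (p j)⁻¹ < (m : ℝ≥0∞) - 3/2)
    (P : ℝ≥0∞) (hP : P⁻¹ = ∑ i, (p i)⁻¹) :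
    ∃ C : ℝ≥0∞, C ≠ ∞ ∧ ∀ f : Fin m → SchwartzMap ℝ ℝ,
      wLpNorm P (Sm m (fun i => ⇑(f i))) ≤ C * ∏ i, eLpNorm (⇑(f i)) (p i) volume := by
  classical
  set K : Finset (Fin m) := Finset.univ.filter (fun i => p i = 1) with hKdef
  have hmK : ∀ i, i ∈ K ↔ p i = 1 := fun i => by simp [hKdef]
  have hKne : K.Nonempty := by
    obtain ⟨i, hi⟩ := hone
    exact ⟨i, (hmK i).2 hi⟩
  have hsum : ∑ i, (p i)⁻¹ = (K.card : ℝ≥0∞) := by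
    have : ∀ i, (p i)⁻¹ = if i ∈ K then (1 : ℝ≥0∞) else 0 := by
      intro i
      rcases hp i with h | h
      · simp [hmK, h]
      · simp [hmK, h]
    simp [this]
  have hcardK : K.card < m - 1 := by
    rw [hsum] at ha
    have : (m : ℝ≥0∞) - 1 = ((m - 1 : ℕ) : ℝ≥0∞) := by
      rw [ENNReal.natCast_sub]; simp
    rw [this] at ha
    exact_mod_cast ha
  have hcc : 1 < Kᶜ.card := by
    rw [Finset.card_compl, Fintype.card_fin]; omega
  obtain ⟨a, haK, b, hbK, hab⟩ := Finset.one_lt_card.1 hcc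
  rw [Finset.mem_compl] at haK hbK
  have hPk : 1 / P.toReal = (K.card : ℝ) := by
    rw [one_div, ← ENNReal.toReal_inv, hP, hsum]; simp
  set c : ℝ≥0∞ := ((volume : Measure (EuclideanSpace ℝ (Fin m))).toSphere Set.univ)⁻¹ with hcdef
  have hct : c ≠ ∞ := by
    have : Nonempty (Fin m) := ⟨a⟩
    rw [hcdef, ENNReal.inv_ne_top, Measure.measure_univ_ne_zero]
    exact Measure.toSphere_ne_zero _
  refine ⟨c * (ENNReal.ofReal (3 * π) * 4 ^ Kᶜ.card) * (K.card * 16) ^ (K.card : ℝ), ?_, ?_⟩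
  · refine ENNReal.mul_ne_top (ENNReal.mul_ne_top hct (ENNReal.mul_ne_top ENNReal.ofReal_ne_top
      (ENNReal.pow_ne_top (by norm_num)))) (ENNReal.rpow_ne_top_of_nonneg (by positivity)
      (ENNReal.mul_ne_top (by simp) (by norm_num)))
  intro f
  have hMt : ∀ i, eLpNorm (f i) ∞ volume ≠ ∞ := fun i => schw_ne_top (f i) ∞
  set D : ℝ≥0∞ := c * (ENNReal.ofReal (3 * π) * 4 ^ Kᶜ.card) * ∏ i ∈ Kᶜ, eLpNorm (f i) ∞ volume with hD
  have hDt : D ≠ ∞ := by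
    refine ENNReal.mul_ne_top (ENNReal.mul_ne_top hct (ENNReal.mul_ne_top ENNReal.ofReal_ne_top
      (ENNReal.pow_ne_top (by norm_num)))) (ENNReal.prod_ne_top fun i _ => hMt i)
  have hprod : ∏ i, eLpNorm (⇑(f i)) (p i) volume =
      (∏ i ∈ K, eLpNorm (f i) 1 volume) * ∏ i ∈ Kᶜ, eLpNorm (f i) ∞ volume := by
    rw [← Finset.prod_mul_prod_compl K]
    congr 1
    · refine Finset.prod_congr rfl fun i hi => ?_
      rw [(hmK i).1 hi]
    · refine Finset.prod_congr rfl fun i hi => ?_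
      rw [Finset.mem_compl, hmK] at hi
      rw [(hp i).resolve_left hi]
  have hpt : ∀ x, Sm m (fun i => ⇑(f i)) x ≤ D * ∏ i ∈ K, HLF (f i) x := by
    intro x
    refine iSup₂_le fun t ht => (sphAvg_le m a b hab K haK hbK f t x ht).trans (le_of_eq ?_)
    rw [← Finset.prod_mul_prod_compl K]
    have e1 : ∏ i ∈ K, (if i ∈ K then HLF (f i) x else 4 * eLpNorm (f i) ∞ volume) = ∏ i ∈ K, HLF (f i) x :=
      Finset.prod_congr rfl fun i hi => by simp [hi]
    have e2 : ∏ i ∈ Kᶜ, (if i ∈ K then HLF (f i) x else 4 * eLpNorm (f i) ∞ volume)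
        = 4 ^ Kᶜ.card * ∏ i ∈ Kᶜ, eLpNorm (f i) ∞ volume := by
      rw [← Finset.prod_const, ← Finset.prod_mul_distrib]
      refine Finset.prod_congr rfl fun i hi => ?_
      rw [Finset.mem_compl] at hi
      simp [hi]
    rw [e1, e2, hD]
    ring
  rw [wLpNorm, hPk]
  refine iSup₂_le fun l hl => ?_
  by_cases hD0 : D = 0
  · have : {x | l < Sm m (fun i => ⇑(f i)) x} = ∅ := by
      ext x
      have := hpt x
      rw [hD0, zero_mul] at this
      simp [le_trans this zero_le]
    simp [this, hKne.card_ne_zero]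
  by_cases hlt : l = ∞
  · simp [hlt, hKne.card_ne_zero]
  have hsub : {x | l < Sm m (fun i => ⇑(f i)) x} ⊆ {x | l / D < ∏ i ∈ K, HLF (f i) x} := by
    intro x hx
    exact ENNReal.div_lt_of_lt_mul' (lt_of_lt_of_le hx (hpt x))
  have hH := weakHolder K hKne (fun i => HLF (f i)) (fun i => eLpNorm (f i) 1 volume)
    (fun i _ => schw_ne_top (f i) 1) 16 (fun i _ h => HLF_zero (f i) h)
    (fun i _ α h1 h2 => HLF_weak (f i) α h1 h2) (l / D) (ENNReal.div_pos hl.ne' hDt)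
  calc l * volume {x | l < Sm m (fun i => ⇑(f i)) x} ^ (K.card : ℝ)
      = D * (l / D * volume {x | l < Sm m (fun i => ⇑(f i)) x} ^ (K.card : ℝ)) := by
        rw [← mul_assoc, ENNReal.mul_div_cancel hD0 hDt]
    _ ≤ D * (l / D * volume {x | l / D < ∏ i ∈ K, HLF (f i) x} ^ (K.card : ℝ)) := by
        gcongr
    _ ≤ D * ((K.card * 16) ^ (K.card : ℝ) * ∏ i ∈ K, eLpNorm (f i) 1 volume) := by
        gcongr
    _ = _ := by
        rw [hprod, hD]; ring
end

section
/- Let m ≥ 2, let 1 ≤ p_i ≤ ∞ for i = 1,…,m, and let 1/p = Σ_{i=1}^m 1/p_i. If there exists a finite constant C such that ‖S^m(f_1,…,f_m)‖_{L^p(ℝ)} ≤ C Π_{i=1}^m ‖f_i‖_{L^{p_i}(ℝ)} for all bounded compactly supported measurable functions f_1,…,f_m, then for every i = 1,…,m one has Σ_{j≠i} 1/p_j ≤ m − 3/2. -/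
open MeasureTheory Real Set
open scoped ENNReal NNReal

def ASet (m : ℕ) (i : Fin m) (d : ℝ) : Set (Metric.sphere (0 : EuclideanSpace ℝ (Fin m)) 1) :=
  {y | ∀ j, j ≠ i → |(y : EuclideanSpace ℝ (Fin m)) j - 1 / √((m:ℝ)-1)| ≤ d}

lemma ASet_meas (m : ℕ) (i : Fin m) (d : ℝ) : MeasurableSet (ASet m i d) := by
  apply IsClosed.measurableSet
  unfold ASet
  simp only [Set.ofPred_forall]
  refine isClosed_iInter fun j => isClosed_iInter fun _ => ?_
  apply isClosed_le <;> fun_prop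

open scoped Pointwise in
lemma key_ineq (m : ℕ) (hm : 2 ≤ m) (i : Fin m) (h b : ℝ) (hh : 0 < h)
    (hb : 1 / (4 * (m:ℝ)) ≤ b) (hbh : b + h ≤ 1 / (2 * (m:ℝ))) (z : EuclideanSpace ℝ (Fin m))
    (hzi : z i ^ 2 ≤ h) (hz : ∀ j, j ≠ i → z j ∈ Set.Ioo b (b + h)) :
    z ∈ Set.Ioo (0:ℝ) 1 • (Subtype.val '' ASet m i (4 * m * (1 + 2 * m) * h)) := by
  have hm' : (2:ℝ) ≤ m := by exact_mod_cast hm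
  have hb0 : 0 < b := lt_of_lt_of_le (by positivity) hb
  have hn : ‖z‖ ^ 2 = z i ^ 2 + ∑ j ∈ Finset.univ.erase i, z j ^ 2 := by
    rw [EuclideanSpace.real_norm_sq_eq, Finset.add_sum_erase _ (fun j => z j ^ 2) (Finset.mem_univ i)]
  have hcard : ((Finset.univ.erase i).card : ℝ) = m - 1 := by
    rw [Finset.card_erase_of_mem (Finset.mem_univ i), Finset.card_univ, Fintype.card_fin,
      Nat.cast_sub (by omega)]; simp
  have hlo : ((m:ℝ) - 1) * b ^ 2 ≤ ‖z‖ ^ 2 := by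
    have : ∑ j ∈ Finset.univ.erase i, b ^ 2 ≤ ∑ j ∈ Finset.univ.erase i, z j ^ 2 := by
      apply Finset.sum_le_sum
      intro j hj
      have := hz j (Finset.ne_of_mem_erase hj)
      have := this.1
      gcongr
    rw [Finset.sum_const, nsmul_eq_mul, hcard] at this
    nlinarith [sq_nonneg (z i)]
  have hhi : ‖z‖ ^ 2 ≤ ((m:ℝ) - 1) * (b + h) ^ 2 + h := by
    have : ∑ j ∈ Finset.univ.erase i, z j ^ 2 ≤ ∑ j ∈ Finset.univ.erase i, (b + h) ^ 2 := by
      apply Finset.sum_le_sum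
      intro j hj
      have := hz j (Finset.ne_of_mem_erase hj)
      have h1 := this.1
      have h2 := this.2
      have : 0 ≤ z j := by linarith
      gcongr
    rw [Finset.sum_const, nsmul_eq_mul, hcard] at this
    linarith
  set s := √((m:ℝ)-1) with hs
  have hs2 : s ^ 2 = m - 1 := Real.sq_sqrt (by linarith)
  have hs1 : 1 ≤ s := by rw [hs]; apply Real.one_le_sqrt.2; linarith
  have hlo' : s * b ≤ ‖z‖ := by
    apply le_of_sq_le_sq _ (norm_nonneg z)
    rw [mul_pow, hs2]; exact hlo
  have hmb : 1 ≤ 4 * m * b := by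
    rw [div_le_iff₀ (by positivity)] at hb; linarith
  have hmbh : 2 * m * (b + h) ≤ 1 := by
    rw [le_div_iff₀ (by positivity)] at hbh; linarith
  have hzpos : 0 < ‖z‖ := lt_of_lt_of_le (by positivity) hlo'
  have hhi' : ‖z‖ ≤ s * (b + h + 2 * m * h) := by
    apply le_of_sq_le_sq _ (by positivity)
    rw [mul_pow, hs2]
    refine hhi.trans ?_
    have : h ≤ (b + h) * (4 * m * h) := by
      have q : 0 ≤ (4 * m * b - 1) * h := mul_nonneg (by linarith) hh.le
      have q2 : 0 ≤ m * h * h := by positivity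
      linarith
    have : (b+h)^2 + h ≤ (b + h + 2 * m * h)^2 := by nlinarith [sq_nonneg (2*m*h)]
    nlinarith
  have hlt : ‖z‖ < 1 := by
    have h1 : ((m:ℝ) - 1) * (b + h) ^ 2 ≤ (b+h) / 2 := by nlinarith
    have : ‖z‖^2 < 1 := by nlinarith
    nlinarith
  refine Set.mem_smul.2 ⟨‖z‖, ⟨hzpos, hlt⟩, ‖z‖⁻¹ • z, ⟨⟨‖z‖⁻¹ • z, ?_⟩, ?_, rfl⟩, ?_⟩
  · simp [norm_smul, hzpos.ne']
  · intro j hj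
    obtain ⟨h1, h2⟩ := hz j hj
    show |‖z‖⁻¹ * z j - 1 / s| ≤ _
    have e : ‖z‖⁻¹ * z j - 1 / s = (z j - ‖z‖ / s) / ‖z‖ := by
      field_simp
    rw [e, abs_div, abs_of_pos hzpos, div_le_iff₀ hzpos]
    have h3 : b ≤ ‖z‖ / s := by rw [le_div_iff₀ (by positivity)]; linarith
    have h4 : ‖z‖ / s ≤ b + h + 2 * m * h := by rw [div_le_iff₀ (by positivity)]; linarith
    have h5 : b ≤ ‖z‖ := by nlinarith
    have h6 : (1 + 2 * m) * h ≤ 4 * m * (1 + 2 * m) * h * ‖z‖ := by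
      have : 1 ≤ 4 * m * ‖z‖ := by nlinarith
      nlinarith [mul_le_mul_of_nonneg_left this (by positivity : 0 ≤ (1 + 2 * m) * h)]
    have h7 : 0 < m * h := by positivity
    rw [abs_le]; constructor <;> linarith
  · rw [smul_smul, mul_inv_cancel₀ hzpos.ne', one_smul]

def box (m : ℕ) (i : Fin m) (h : ℝ) (k : ℕ) : Set (Fin m → ℝ) :=
  Set.pi univ (fun j => if j = i then Ioo (-√h) √h else Ioo (k * h) (k * h + h))

lemma box_vol (m : ℕ) (i : Fin m) (h : ℝ) (hh : 0 < h) (k : ℕ) :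
    volume (box m i h k) = ENNReal.ofReal (2 * √h * h ^ (m - 1)) := by
  unfold box
  rw [volume_pi_pi, ← Finset.mul_prod_erase _ _ (Finset.mem_univ i)]
  rw [Finset.prod_congr rfl (g := fun _ => ENNReal.ofReal h), Finset.prod_const,
    Finset.card_erase_of_mem (Finset.mem_univ i), Finset.card_univ, Fintype.card_fin,
    ENNReal.ofReal_mul (by positivity), ENNReal.ofReal_pow hh.le]
  · rw [if_pos rfl, Real.volume_Ioo]; congr 2; ring
  · intro j hj
    simp [Finset.ne_of_mem_erase hj]

open scoped Pointwise in
lemma cone_vol (m : ℕ) (hm : 2 ≤ m) (i : Fin m) (N : ℕ) (hN : 0 < N) (h : ℝ)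
    (hh : h = 1 / (4 * m * N)) :
    ENNReal.ofReal (N * (2 * √h * h ^ (m - 1))) ≤
      volume (Set.Ioo (0:ℝ) 1 • (Subtype.val '' ASet m i (4 * m * (1 + 2 * m) * h)) :
        Set (EuclideanSpace ℝ (Fin m))) := by
  have hm' : (2:ℝ) ≤ m := by exact_mod_cast hm
  have hN' : (1:ℝ) ≤ N := by exact_mod_cast hN
  have hpos : 0 < h := by rw [hh]; positivity
  have hbm : ∀ k, MeasurableSet (box m i h k) := fun k => by
    apply MeasurableSet.univ_pi
    intro j; split_ifs <;> exact measurableSet_Ioo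
  have hNh : N * h = 1 / (4 * m) := by rw [hh]; field_simp
  have hsub : WithLp.ofLp ⁻¹' (⋃ k ∈ Finset.Ico N (2*N), box m i h k) ⊆
      (Set.Ioo (0:ℝ) 1 • (Subtype.val '' ASet m i (4 * m * (1 + 2 * m) * h)) :
        Set (EuclideanSpace ℝ (Fin m))) := by
    intro z hz
    simp only [mem_preimage, mem_iUnion, Finset.mem_Ico, exists_prop] at hz
    obtain ⟨k, ⟨hk1, hk2⟩, hz⟩ := hz
    have hz' : ∀ j, z j ∈ if j = i then Ioo (-√h) √h else Ioo (k * h) (k * h + h) :=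
      fun j => hz j (mem_univ j)
    refine key_ineq m hm i h (k * h) hpos ?_ ?_ z ?_ ?_
    · rw [← hNh]; gcongr
    · have : (k:ℝ) + 1 ≤ 2 * N := by exact_mod_cast hk2
      calc k * h + h = (k + 1) * h := by ring
        _ ≤ 2 * N * h := by gcongr
        _ = 1 / (2 * m) := by rw [mul_assoc, hNh]; field_simp; norm_num
    · have := hz' i
      rw [if_pos rfl] at this
      have h2 : |z i| ≤ √h := abs_le.2 ⟨this.1.le, this.2.le⟩
      calc z i ^ 2 = |z i| ^ 2 := (sq_abs _).symm
        _ ≤ √h ^ 2 := by gcongr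
        _ = h := Real.sq_sqrt hpos.le
    · intro j hj
      have := hz' j
      rwa [if_neg hj] at this
  refine le_trans ?_ (measure_mono hsub)
  rw [(PiLp.volume_preserving_ofLp (Fin m)).measure_preimage
    (MeasurableSet.nullMeasurableSet (Finset.measurableSet_biUnion _ fun k _ => hbm k)),
    measure_biUnion_finset _ (fun k _ => hbm k)]
  · simp only [box_vol m i h hpos]
    rw [Finset.sum_const, Nat.card_Ico, nsmul_eq_mul, ENNReal.ofReal_mul (by positivity)]
    have : 2 * N - N = N := by omega
    rw [this]; simp
  · intro k _ l _ hkl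
    rw [Function.onFun, Set.disjoint_left]
    intro z hz1 hz2
    obtain ⟨j, hj⟩ : ∃ j : Fin m, j ≠ i := by
      have : Nontrivial (Fin m) := Fin.nontrivial_iff_two_le.2 hm
      exact exists_ne i
    have h1 := hz1 j (mem_univ j)
    have h2 := hz2 j (mem_univ j)
    simp only [if_neg hj, mem_Ioo] at h1 h2
    apply hkl
    have a1 : (k:ℝ) < l + 1 := by nlinarith
    have a2 : (l:ℝ) < k + 1 := by nlinarith
    have a1' : k < l + 1 := by exact_mod_cast a1
    have a2' : l < k + 1 := by exact_mod_cast a2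
    omega

lemma sph_lower (m : ℕ) (hm : 2 ≤ m) (i : Fin m) : ∃ κ : ℝ≥0∞, κ ≠ 0 ∧ ∀ N : ℕ, 0 < N →
    κ * ENNReal.ofReal ((N:ℝ) ^ (3/2 - (m:ℝ))) ≤ sphMeasure m (ASet m i ((1 + 2 * m) / N)) := by
  have hm' : (2:ℝ) ≤ m := by exact_mod_cast hm
  refine ⟨((volume : Measure (EuclideanSpace ℝ (Fin m))).toSphere Set.univ)⁻¹ * (m *
    ENNReal.ofReal (2 * (1 / (4 * m) : ℝ) ^ ((m:ℝ) - 1/2))), ?_, ?_⟩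
  · refine mul_ne_zero (ENNReal.inv_ne_zero.2 (measure_ne_top _ _)) (mul_ne_zero ?_ ?_)
    · simp; omega
    · have : (0:ℝ) < 2 * (1 / (4 * m) : ℝ) ^ ((m:ℝ) - 1/2) := by positivity
      simpa using this
  · intro N hN
    have hN' : (1:ℝ) ≤ N := by exact_mod_cast hN
    have h := cone_vol m hm i N hN _ rfl
    have e1 : 4 * (m:ℝ) * (1 + 2 * m) * (1 / (4 * m * N)) = (1 + 2 * m) / N := by field_simp
    rw [e1] at h
    have e2 : N * (2 * √(1 / (4 * (m:ℝ) * N)) * (1 / (4 * (m:ℝ) * N)) ^ (m - 1))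
        = 2 * (1 / (4 * m) : ℝ) ^ ((m:ℝ) - 1/2) * (N:ℝ) ^ (3/2 - (m:ℝ)) := by
      have hx : (0:ℝ) < 1 / (4 * (m:ℝ) * N) := by positivity
      have a1 : √(1 / (4 * (m:ℝ) * N)) * (1 / (4 * (m:ℝ) * N)) ^ (m - 1)
          = (1 / (4 * (m:ℝ) * N)) ^ ((m:ℝ) - 1/2) := by
        rw [Real.sqrt_eq_rpow, ← Real.rpow_natCast, ← Real.rpow_add hx, Nat.cast_sub (by omega)]
        congr 1; push_cast; ring
      have a2 : (1 / (4 * (m:ℝ) * N)) ^ ((m:ℝ) - 1/2)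
          = (1 / (4 * (m:ℝ))) ^ ((m:ℝ) - 1/2) * (N:ℝ) ^ (1/2 - (m:ℝ)) := by
        have : 1 / (4 * (m:ℝ) * N) = 1 / (4 * (m:ℝ)) * (N:ℝ)⁻¹ := by field_simp
        rw [this, Real.mul_rpow (by positivity) (by positivity), Real.inv_rpow (by positivity),
          ← Real.rpow_neg (by positivity)]
        congr 2; ring
      have a3 : (N:ℝ) ^ (3/2 - (m:ℝ)) = N * (N:ℝ) ^ (1/2 - (m:ℝ)) := by
        rw [← Real.rpow_one_add' (by positivity)]
        · congr 1; ring
        · intro h; linarith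
      rw [mul_assoc 2, a1, a2, a3]; ring
    rw [e2, ENNReal.ofReal_mul (by positivity)] at h
    rw [sphMeasure, Measure.smul_apply, smul_eq_mul,
      Measure.toSphere_apply' _ (ASet_meas _ _ _), finrank_euclideanSpace_fin, mul_assoc, mul_assoc]
    gcongr

noncomputable def tf (m : ℕ) (i : Fin m) (N : ℕ) (j : Fin m) : ℝ → ℝ :=
  Set.indicator (if j = i then Set.Icc (-(4 * (m:ℝ))) (4 * m)
    else Set.Icc (-(2 * m * ((1 + 2 * (m:ℝ)) / N))) (2 * m * ((1 + 2 * (m:ℝ)) / N))) (fun _ => (1:ℝ))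

lemma Sm_lower (m : ℕ) (hm : 2 ≤ m) (i : Fin m) (N : ℕ) (hN : 0 < N) (x : ℝ)
    (hx : x ∈ Set.Icc (1:ℝ) 2) :
    sphMeasure m (ASet m i ((1 + 2 * m) / N)) ≤ Sm m (tf m i N) x := by
  have hm' : (2:ℝ) ≤ m := by exact_mod_cast hm
  set s := √((m:ℝ)-1) with hs
  have hs2 : s ^ 2 = m - 1 := Real.sq_sqrt (by linarith)
  have hs1 : 1 ≤ s := by rw [hs]; apply Real.one_le_sqrt.2; linarith
  have hsm : s ≤ m := by nlinarith
  obtain ⟨hx1, hx2⟩ := hx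
  have ht : 0 < s * x := by positivity
  have ht2 : s * x ≤ 2 * m := by nlinarith
  refine le_trans ?_ (le_iSup₂_of_le (s * x) ht le_rfl)
  unfold sphAvg
  rw [← lintegral_indicator_one (ASet_meas _ _ _)]
  apply lintegral_mono
  intro y
  by_cases hy : y ∈ ASet m i ((1 + 2 * m) / N)
  swap
  · simp [hy]
  rw [Set.indicator_of_mem hy, Pi.one_apply]
  refine le_of_eq (Eq.symm ?_)
  apply Finset.prod_eq_one
  intro j _
  have : tf m i N j (x - s * x * (y : EuclideanSpace ℝ (Fin m)) j) = 1 := by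
    unfold tf
    rw [Set.indicator_of_mem]
    split_ifs with hj
    · have hy1 : |(y : EuclideanSpace ℝ (Fin m)) j| ≤ 1 := by
        have h1 := EuclideanSpace.norm_sq_eq (y : EuclideanSpace ℝ (Fin m))
        have h2 := PiLp.norm_apply_le (y : EuclideanSpace ℝ (Fin m)) j
        have h3 : ‖(y : EuclideanSpace ℝ (Fin m))‖ = 1 := by simpa using y.2
        rw [h3] at h2
        simpa using h2
      have := abs_le.1 hy1
      constructor <;> nlinarith
    · have h1 := hy j hj
      rw [← hs] at h1
      have e : x - s * x * (y : EuclideanSpace ℝ (Fin m)) j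
          = -(s * x * ((y : EuclideanSpace ℝ (Fin m)) j - 1 / s)) := by
        field_simp; ring
      rw [e, Set.mem_Icc, ← abs_le, abs_neg, abs_mul, abs_of_pos ht]
      gcongr
  rw [this]; simp

lemma lp_lower_s7 (P a : ℝ≥0∞) (hP : P ≠ 0) (F : ℝ → ℝ≥0∞) (h : ∀ x ∈ Set.Icc (1:ℝ) 2, a ≤ F x) :
    a ≤ _root_.lpNorm P F := by
  unfold _root_.lpNorm
  split_ifs with hPt
  · by_contra hlt
    push Not at hlt
    have := ae_lt_of_essSup_lt hlt
    have h2 : volume (Set.Icc (1:ℝ) 2) ≤ volume {x | ¬ F x < a} :=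
      measure_mono fun x hx => not_lt.2 (h x hx)
    rw [ae_iff.1 this] at h2
    norm_num at h2
  · have hp : 0 < P.toReal := ENNReal.toReal_pos hP hPt
    have : a ^ P.toReal ≤ ∫⁻ x, F x ^ P.toReal := by
      calc a ^ P.toReal = ∫⁻ x in Set.Icc (1:ℝ) 2, a ^ P.toReal := by
            rw [setLIntegral_const]; norm_num
        _ ≤ ∫⁻ x in Set.Icc (1:ℝ) 2, F x ^ P.toReal := by
            apply setLIntegral_mono' measurableSet_Icc
            intro x hx
            exact ENNReal.rpow_le_rpow (h x hx) hp.le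
        _ ≤ _ := setLIntegral_le_lintegral _ _
    calc a = (a ^ P.toReal) ^ (1 / P.toReal) := by
          rw [← ENNReal.rpow_mul, mul_one_div_cancel hp.ne', ENNReal.rpow_one]
      _ ≤ _ := ENNReal.rpow_le_rpow this (by positivity)

lemma tf_ok (m : ℕ) (i : Fin m) (N : ℕ) (j : Fin m) : Measurable (tf m i N j) ∧
    (∃ M : ℝ, ∀ x, |tf m i N j x| ≤ M) ∧ HasCompactSupport (tf m i N j) := by
  refine ⟨?_, ⟨1, ?_⟩, ?_⟩
  · apply Measurable.indicator measurable_const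
    split_ifs <;> exact measurableSet_Icc
  · intro x
    unfold tf
    by_cases hx : x ∈ (if j = i then Set.Icc (-(4 * (m:ℝ))) (4 * m)
      else Set.Icc (-(2 * m * ((1 + 2 * (m:ℝ)) / N))) (2 * m * ((1 + 2 * (m:ℝ)) / N)))
    · rw [Set.indicator_of_mem hx]; simp
    · rw [Set.indicator_of_notMem hx]; simp
  · unfold tf
    split_ifs
    · exact HasCompactSupport.intro isCompact_Icc fun x hx => Set.indicator_of_notMem hx _
    · exact HasCompactSupport.intro isCompact_Icc fun x hx => Set.indicator_of_notMem hx _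

lemma tf_norm (m : ℕ) (i : Fin m) (p : Fin m → ℝ≥0∞) : ∃ K : ℝ≥0∞, K ≠ ∞ ∧ ∀ N : ℕ, 0 < N →
    ∏ j, eLpNorm (tf m i N j) (p j) volume ≤
      K * ENNReal.ofReal ((N:ℝ) ^ (-∑ j ∈ Finset.univ.erase i, 1 / (p j).toReal)) := by
  refine ⟨ENNReal.ofReal (8 * m) ^ (1 / (p i).toReal) * ∏ j ∈ Finset.univ.erase i,
    ENNReal.ofReal ((4 * m * (1 + 2 * (m:ℝ))) ^ (1 / (p j).toReal)), ?_, ?_⟩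
  · refine ENNReal.mul_ne_top (ENNReal.rpow_ne_top_of_nonneg (by positivity) ENNReal.ofReal_ne_top) ?_
    exact ENNReal.prod_ne_top fun _ _ => ENNReal.ofReal_ne_top
  · intro N hN
    have hN' : (0:ℝ) < N := by exact_mod_cast hN
    rw [← Finset.mul_prod_erase _ _ (Finset.mem_univ i), mul_assoc]
    gcongr
    · refine (eLpNorm_indicator_const_le _ _).trans (le_of_eq ?_)
      rw [if_pos rfl, Real.volume_Icc]
      simp only [enorm_one, one_mul]
      congr 2; ring
    · rw [← Finset.sum_neg_distrib, Real.rpow_sum_of_pos hN',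
        ENNReal.ofReal_prod_of_nonneg (fun _ _ => by positivity), ← Finset.prod_mul_distrib]
      apply Finset.prod_le_prod'
      intro j hj
      refine (eLpNorm_indicator_const_le _ _).trans (le_of_eq ?_)
      rw [if_neg (Finset.ne_of_mem_erase hj), Real.volume_Icc]
      simp only [enorm_one, one_mul]
      rw [ENNReal.ofReal_rpow_of_nonneg (by ring_nf; positivity) (by positivity),
        ← ENNReal.ofReal_mul (by positivity), Real.rpow_neg hN'.le, ← Real.inv_rpow hN'.le,
        ← Real.mul_rpow (by positivity) (by positivity)]
      congr 2; ring

/-- Necessity of condition (b): if the strong-type bound holds for all bounded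
compactly supported measurable functions, then `Σ_{j≠i} 1/pⱼ ≤ m - 3/2` for every `i`. -/
theorem multilinear_spherical_maximal_necessity_b
    (m : ℕ) (hm : 2 ≤ m) (p : Fin m → ℝ≥0∞) (hp : ∀ i, 1 ≤ p i)
    (P : ℝ≥0∞) (hP : P⁻¹ = ∑ i, (p i)⁻¹)
    (hbound : ∃ C : ℝ≥0∞, C ≠ ∞ ∧ ∀ f : Fin m → ℝ → ℝ,
      (∀ i, Measurable (f i) ∧ (∃ M : ℝ, ∀ x, |f i x| ≤ M) ∧ HasCompactSupport (f i)) →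
      lpNorm P (Sm m f) ≤ C * ∏ i, eLpNorm (f i) (p i) volume) :
    ∀ i, ∑ j ∈ Finset.univ.erase i, (p j)⁻¹ ≤ (m : ℝ≥0∞) - 3/2 := by
  intro i
  obtain ⟨C, hC, hb⟩ := hbound
  obtain ⟨κ, hκ, hlow⟩ := sph_lower m hm i
  obtain ⟨K, hK, hup⟩ := tf_norm m i p
  have hm' : (2:ℝ) ≤ m := by exact_mod_cast hm
  have hpinv : ∀ j, (p j)⁻¹ ≠ ∞ := fun j =>
    ENNReal.inv_ne_top.2 (lt_of_lt_of_le one_pos (hp j)).ne'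
  have hP0 : P ≠ 0 := by
    intro h
    rw [h, ENNReal.inv_zero] at hP
    exact ENNReal.sum_ne_top.2 (fun j _ => hpinv j) hP.symm
  set S := ∑ j ∈ Finset.univ.erase i, 1 / (p j).toReal with hS
  have hsum : ∑ j ∈ Finset.univ.erase i, (p j)⁻¹ = ENNReal.ofReal S := by
    rw [hS, ENNReal.ofReal_sum_of_nonneg (fun _ _ => by positivity)]
    refine Finset.sum_congr rfl fun j _ => ?_
    rw [one_div, ← ENNReal.toReal_inv, ENNReal.ofReal_toReal (hpinv j)]
  have hr : (m : ℝ≥0∞) - 3/2 = ENNReal.ofReal (m - 3/2) := by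
    rw [ENNReal.ofReal_sub _ (by norm_num), ENNReal.ofReal_natCast,
      ENNReal.ofReal_div_of_pos (by norm_num)]
    norm_num
  rw [hsum, hr]
  apply ENNReal.ofReal_le_ofReal
  by_contra hlt
  push Not at hlt
  have key : ∀ N : ℕ, 0 < N → (N:ℝ) ^ (S - (m - 3/2)) ≤ ((C * K) / κ).toReal := by
    intro N hN
    have hN' : (0:ℝ) < N := by exact_mod_cast hN
    have h1 : κ * ENNReal.ofReal ((N:ℝ) ^ (3/2 - (m:ℝ))) ≤
        C * (K * ENNReal.ofReal ((N:ℝ) ^ (-S))) := by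
      refine (hlow N hN).trans ?_
      refine (lp_lower_s7 P _ hP0 (Sm m (tf m i N)) (fun x hx => Sm_lower m hm i N hN x hx)).trans ?_
      refine (hb _ (tf_ok m i N)).trans ?_
      gcongr
      exact hup N hN
    have h2 : κ * ENNReal.ofReal ((N:ℝ) ^ (S - (m - 3/2))) ≤ C * K := by
      have h3 := mul_le_mul_left h1 (ENNReal.ofReal ((N:ℝ) ^ S))
      rw [mul_assoc, ← mul_assoc C, mul_assoc (C * K), ← ENNReal.ofReal_mul (by positivity),
        ← ENNReal.ofReal_mul (by positivity), ← Real.rpow_add hN', ← Real.rpow_add hN'] at h3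
      rw [neg_add_cancel, Real.rpow_zero, ENNReal.ofReal_one, mul_one] at h3
      convert h3 using 4; ring
    have hfin : (C * K) / κ ≠ ∞ := ENNReal.div_ne_top (ENNReal.mul_ne_top hC hK) hκ
    rw [← ENNReal.ofReal_le_iff_le_toReal hfin]
    rw [ENNReal.le_div_iff_mul_le (Or.inl hκ) (Or.inr (ENNReal.mul_ne_top hC hK)), mul_comm]
    exact h2
  have htend := (tendsto_rpow_atTop (sub_pos.2 hlt)).comp (tendsto_natCast_atTop_atTop (R := ℝ))
  obtain ⟨N, hN1, hN2⟩ := ((htend.eventually_gt_atTop ((C * K) / κ).toReal).and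
    (Filter.eventually_gt_atTop 0)).exists
  exact absurd (key N hN2) (not_le.2 hN1)
end

section
/- Let m ≥ 3 and let f_1,…,f_m : ℝ → [0,∞) be measurable. Then there is a constant C_m < ∞, depending only on m, such that for every x ∈ ℝ and every t > 0, S^m_t(f_1,…,f_m)(x) ≤ C_m · S²(f_1,f_2)(x) · M^{m−2}(f_3,…,f_m)(x). Consequently S^m(f_1,…,f_m)(x) ≤ C_m · S²(f_1,f_2)(x) · M^{m−2}(f_3,…,f_m)(x) for every x ∈ ℝ. -/
open MeasureTheory Real Set
open scoped ENNReal NNReal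

theorem lemA {E : Type*} [NormedAddCommGroup E] [NormedSpace ℝ E] [FiniteDimensional ℝ E]
    [MeasurableSpace E] [BorelSpace E] [Nontrivial E] (μ : Measure E) [μ.IsAddHaarMeasure]
    (G : E → ℝ≥0∞) (hG : Measurable G) :
    ∫⁻ y, (if ‖y‖ < 1 then G (‖y‖⁻¹ • y) else 0) ∂μ =
      (∫⁻ y : Metric.sphere (0 : E) 1, G y ∂μ.toSphere) *
        ENNReal.ofReal (1 / (Module.finrank ℝ E : ℝ)) := by
  have hpos : 0 < Module.finrank ℝ E := Module.finrank_pos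
  have h1 : ∫⁻ y, (if ‖y‖ < 1 then G (‖y‖⁻¹ • y) else 0) ∂μ =
      ∫⁻ y : ({(0)}ᶜ : Set E), (if ‖y.1‖ < 1 then G (‖y.1‖⁻¹ • y.1) else 0) ∂(μ.comap (↑)) := by
    rw [lintegral_subtype_comap (measurableSet_singleton _).compl
      (fun y : E => if ‖y‖ < 1 then G (‖y‖⁻¹ • y) else 0)]
    rw [restrict_compl_singleton]
  rw [h1]
  have h2 := (μ.measurePreserving_homeomorphUnitSphereProd).lintegral_comp_emb
    (Homeomorph.measurableEmbedding _)
    (fun q : Metric.sphere (0 : E) 1 × Ioi (0:ℝ) => G q.1 * (Iio (⟨1, mem_Ioi.2 one_pos⟩ : Ioi (0:ℝ))).indicator 1 q.2)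
  rw [lintegral_prod_mul (f := fun y : Metric.sphere (0 : E) 1 => G y)
    (g := (Iio (⟨1, mem_Ioi.2 one_pos⟩ : Ioi (0:ℝ))).indicator 1)] at h2
  · rw [lintegral_indicator_one measurableSet_Iio, Measure.volumeIoiPow_apply_Iio] at h2
    have h3 : ((Module.finrank ℝ E - 1 : ℕ) : ℝ) + 1 = Module.finrank ℝ E := by
      have : Module.finrank ℝ E - 1 + 1 = Module.finrank ℝ E := by omega
      exact_mod_cast this
    simp only [one_pow, h3] at h2
    rw [← h2]
    apply lintegral_congr
    intro y
    simp only [homeomorphUnitSphereProd_apply_fst_coe, Set.indicator_apply, mem_Iio, Pi.one_apply]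
    have : (((homeomorphUnitSphereProd E) y).2 < (⟨1, mem_Ioi.2 one_pos⟩ : Ioi (0:ℝ))) ↔ ‖y.1‖ < 1 := by
      rw [← Subtype.coe_lt_coe, homeomorphUnitSphereProd_apply_snd_coe]
    simp only [this]
    split_ifs <;> simp
  · exact (hG.comp measurable_subtype_coe).aemeasurable
  · exact (measurable_one.indicator measurableSet_Iio).aemeasurable

theorem lemB (k : ℕ) (H : (Fin (k+2) → ℝ) → ℝ≥0∞) (hH : Measurable H) :
    ∫⁻ y : EuclideanSpace ℝ (Fin (k+2)), H (fun i => y i) =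
      ∫⁻ z : Fin k → ℝ, ∫⁻ p : ℝ × ℝ, H (Fin.cons p.1 (Fin.cons p.2 z)) := by
  have h0 : ∫⁻ y : EuclideanSpace ℝ (Fin (k+2)), H (fun i => y i) = ∫⁻ y : Fin (k+2) → ℝ, H y :=
    ((EuclideanSpace.volume_preserving_symm_measurableEquiv_toLp (Fin (k+2)))).lintegral_comp_emb
      (MeasurableEquiv.measurableEmbedding _) H
  have cons1 : ∀ n : ℕ, Measurable (fun q : ℝ × (Fin n → ℝ) => (Fin.cons q.1 q.2 : Fin (n+1) → ℝ)) := by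
    intro n
    rw [measurable_pi_iff]
    intro i
    refine Fin.cases ?_ (fun j => ?_) i
    · simpa using measurable_fst
    · simp only [Fin.cons_succ]; fun_prop
  have step : ∀ (n : ℕ) (F : (Fin (n+1) → ℝ) → ℝ≥0∞), Measurable F →
      ∫⁻ y, F y = ∫⁻ a : ℝ, ∫⁻ z : Fin n → ℝ, F (Fin.cons a z) := by
    intro n F hF
    have := ((volume_preserving_piFinSuccAbove (fun _ : Fin (n+1) => ℝ) 0).symm).lintegral_comp_emb
      (MeasurableEquiv.measurableEmbedding _) F
    rw [← this, Measure.volume_eq_prod, lintegral_prod]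
    · simp [MeasurableEquiv.piFinSuccAbove, Fin.insertNthEquiv]
    · exact (hF.comp (MeasurableEquiv.measurable _)).aemeasurable
  rw [h0, step _ _ hH]
  have h3 : Measurable (fun q : (ℝ × ℝ) × (Fin k → ℝ) => H (Fin.cons q.1.1 (Fin.cons q.1.2 q.2))) := by
    apply hH.comp
    exact (cons1 (k+1)).comp ((measurable_fst.comp measurable_fst).prodMk ((cons1 k).comp ((measurable_snd.comp measurable_fst).prodMk measurable_snd)))
  have h2 : ∀ a : ℝ, ∫⁻ z : Fin (k+1) → ℝ, H (Fin.cons a z) = ∫⁻ b : ℝ, ∫⁻ z : Fin k → ℝ, H (Fin.cons a (Fin.cons b z)) := by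
    intro a
    apply step k (fun y => H (Fin.cons a y))
    exact hH.comp ((cons1 (k+1)).comp (measurable_const.prodMk measurable_id))
  simp only [h2]
  have h6 : Measurable (fun p : ℝ × ℝ => ∫⁻ z : Fin k → ℝ, H (Fin.cons p.1 (Fin.cons p.2 z))) :=
    h3.lintegral_prod_right'
  have h4 := lintegral_prod (μ := (volume : Measure ℝ)) (ν := (volume : Measure ℝ)) _
    h6.aemeasurable
  have h5 := lintegral_lintegral_swap (μ := (volume : Measure (Fin k → ℝ)))
    (ν := ((volume : Measure ℝ).prod (volume : Measure ℝ)))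
    (f := fun z p => H (Fin.cons p.1 (Fin.cons p.2 z))) (h3.comp measurable_swap).aemeasurable
  rw [Measure.volume_eq_prod, h5]
  exact h4.symm

theorem lemD (N : ℝ) (hN : 0 ≤ N) (K : ℝ → ℝ → ℝ≥0∞) :
    ∫⁻ r in Ioi (0:ℝ), ENNReal.ofReal r * K r (√(r^2+N)) =
      ∫⁻ ρ in Ioi (√N), ENNReal.ofReal ρ * K (√(ρ^2-N)) ρ := by
  have key : ∀ ρ ∈ Ioi (√N), 0 < ρ ∧ 0 < ρ^2 - N := by
    intro ρ hρ
    have hρ : √N < ρ := hρ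
    have h0 := Real.sqrt_nonneg N
    have h1 := Real.sq_sqrt hN
    exact ⟨by linarith, by nlinarith⟩
  have himg : (fun ρ : ℝ => √(ρ^2-N)) '' Ioi (√N) = Ioi 0 := by
    ext r
    constructor
    · rintro ⟨ρ, hρ, rfl⟩
      exact Real.sqrt_pos.2 (key ρ hρ).2
    · intro hr
      have hr : 0 < r := hr
      refine ⟨√(r^2+N), ?_, ?_⟩
      · exact Real.sqrt_lt_sqrt hN (by nlinarith)
      · simp only
        rw [Real.sq_sqrt (by positivity)]
        simp [Real.sqrt_sq hr.le]
  have hd : ∀ ρ ∈ Ioi (√N), HasDerivWithinAt (fun ρ : ℝ => √(ρ^2-N)) (ρ / √(ρ^2-N)) (Ioi (√N)) ρ := by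
    intro ρ hρ
    have h := (((hasDerivAt_id ρ).pow 2).sub_const N).sqrt (by simpa using (key ρ hρ).2.ne')
    convert! h.hasDerivWithinAt using 1
    simp
    field_simp
  have hinj : InjOn (fun ρ : ℝ => √(ρ^2-N)) (Ioi (√N)) := by
    intro a ha b hb hab
    have := (Real.sqrt_inj (key a ha).2.le (key b hb).2.le).1 hab
    have ha' := (key a ha).1
    have hb' := (key b hb).1
    nlinarith
  rw [← himg, lintegral_image_eq_lintegral_abs_deriv_mul measurableSet_Ioi hd hinj]
  apply setLIntegral_congr_fun measurableSet_Ioi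
  intro ρ hρ
  obtain ⟨h1, h2⟩ := key ρ hρ
  have h3 := Real.sqrt_pos.2 h2
  simp only
  rw [← mul_assoc, ← ENNReal.ofReal_mul (abs_nonneg _), abs_of_pos (by positivity),
    Real.sq_sqrt h2.le, div_mul_cancel₀ _ h3.ne', sub_add_cancel, Real.sqrt_sq h1.le]

theorem core (k : ℕ) (Q : (ℝ × ℝ) × (Fin k → ℝ) → ℝ≥0∞) (hQ : Measurable Q) :
    ∫⁻ z : Fin k → ℝ, ∫⁻ p : ℝ × ℝ,
      (if √(p.1^2 + p.2^2 + ∑ i, z i ^ 2) < 1 then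
        Q (((√(p.1^2 + p.2^2 + ∑ i, z i ^ 2))⁻¹ * p.1, (√(p.1^2 + p.2^2 + ∑ i, z i ^ 2))⁻¹ * p.2),
          (√(p.1^2 + p.2^2 + ∑ i, z i ^ 2))⁻¹ • z) else 0) ≤
    ∫⁻ w : Fin k → ℝ, (if ∑ i, w i ^ 2 < 1 then
      ∫⁻ θ in Ioo (-π) π, Q ((√(1 - ∑ i, w i ^ 2) * cos θ, √(1 - ∑ i, w i ^ 2) * sin θ), w)
      else 0) := by
  set Φ : (Fin k → ℝ) → ℝ≥0∞ := fun w => (if ∑ i, w i ^ 2 < 1 then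
      ∫⁻ θ in Ioo (-π) π, Q ((√(1 - ∑ i, w i ^ 2) * cos θ, √(1 - ∑ i, w i ^ 2) * sin θ), w)
      else 0) with hΦ
  have hΦm : Measurable Φ := by
    refine Measurable.ite (measurableSet_lt (by fun_prop) measurable_const) ?_ measurable_const
    have : Measurable (fun q : (Fin k → ℝ) × ℝ =>
        Q ((√(1 - ∑ i, q.1 i ^ 2) * cos q.2, √(1 - ∑ i, q.1 i ^ 2) * sin q.2), q.1)) := by
      apply hQ.comp
      fun_prop
    exact this.lintegral_prod_right'
  have h1 : ∀ z : Fin k → ℝ, ∫⁻ p : ℝ × ℝ,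
      (if √(p.1^2 + p.2^2 + ∑ i, z i ^ 2) < 1 then
        Q (((√(p.1^2 + p.2^2 + ∑ i, z i ^ 2))⁻¹ * p.1, (√(p.1^2 + p.2^2 + ∑ i, z i ^ 2))⁻¹ * p.2),
          (√(p.1^2 + p.2^2 + ∑ i, z i ^ 2))⁻¹ • z) else 0) ≤
      ∫⁻ ρ in Ioo (0:ℝ) 1, ENNReal.ofReal ρ * Φ (ρ⁻¹ • z) := by
    intro z
    have hN : 0 ≤ ∑ i, z i ^ 2 := Finset.sum_nonneg fun i _ => sq_nonneg _
    generalize hNd : ∑ i, z i ^ 2 = N at hN ⊢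
    set K : ℝ → ℝ → ℝ≥0∞ := fun r ρ => if ρ < 1 then
      ∫⁻ θ in Ioo (-π) π, Q ((ρ⁻¹ * (r * cos θ), ρ⁻¹ * (r * sin θ)), ρ⁻¹ • z) else 0 with hK
    have hmeas : Measurable (fun p : ℝ × ℝ => if √(p.1^2 + p.2^2 + N) < 1 then
        Q (((√(p.1^2 + p.2^2 + N))⁻¹ * p.1, (√(p.1^2 + p.2^2 + N))⁻¹ * p.2),
          (√(p.1^2 + p.2^2 + N))⁻¹ • z) else 0) := by
      refine Measurable.ite (measurableSet_lt (by fun_prop) measurable_const) ?_ measurable_const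
      apply hQ.comp
      fun_prop
    have e1 := lintegral_comp_polarCoord_symm (fun p : ℝ × ℝ => if √(p.1^2 + p.2^2 + N) < 1 then
        Q (((√(p.1^2 + p.2^2 + N))⁻¹ * p.1, (√(p.1^2 + p.2^2 + N))⁻¹ * p.2),
          (√(p.1^2 + p.2^2 + N))⁻¹ • z) else 0)
    rw [← e1]
    have ht : polarCoord.target = Ioi (0:ℝ) ×ˢ Ioo (-π) π := rfl
    have hcs : ∀ r θ : ℝ, (r * cos θ)^2 + (r * sin θ)^2 = r^2 := by
      intro r θ
      have := Real.sin_sq_add_cos_sq θ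
      linear_combination r^2 * this
    rw [ht, Measure.volume_eq_prod, setLIntegral_prod]
    · have e2 : ∫⁻ r in Ioi (0:ℝ), ENNReal.ofReal r * K r (√(r^2+N)) =
        ∫⁻ (x : ℝ) in Ioi 0, ∫⁻ (y : ℝ) in Ioo (-π) π,
          ENNReal.ofReal (x, y).1 • (fun p : ℝ × ℝ => if √(p.1^2 + p.2^2 + N) < 1 then
        Q (((√(p.1^2 + p.2^2 + N))⁻¹ * p.1, (√(p.1^2 + p.2^2 + N))⁻¹ * p.2),
          (√(p.1^2 + p.2^2 + N))⁻¹ • z) else 0) (polarCoord.symm (x, y)) := by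
        apply lintegral_congr
        intro r
        simp only [polarCoord_symm_apply, hcs, smul_eq_mul, hK]
        rw [lintegral_const_mul' _ _ ENNReal.ofReal_ne_top]
        split_ifs <;> simp
      rw [← e2, lemD N hN K, ← lintegral_indicator measurableSet_Ioi,
        ← lintegral_indicator measurableSet_Ioo]
      apply lintegral_mono
      intro ρ
      simp only [indicator_apply, mem_Ioi, mem_Ioo, hK]
      split_ifs with a b c c
      · have hρ : 0 < ρ := c.1
        have hlt : N < ρ^2 := (Real.sqrt_lt' hρ).1 a
        have hs : ∑ i, (ρ⁻¹ • z) i ^ 2 = N / ρ^2 := by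
          rw [← hNd, Finset.sum_div]
          apply Finset.sum_congr rfl
          intro i _
          simp only [Pi.smul_apply, smul_eq_mul]
          field_simp
        have hq : √(1 - N / ρ^2) = ρ⁻¹ * √(ρ^2 - N) := by
          rw [show 1 - N / ρ^2 = (ρ⁻¹)^2 * (ρ^2 - N) by field_simp,
            Real.sqrt_mul (by positivity), Real.sqrt_sq (by positivity)]
        have hl : N / ρ^2 < 1 := by rw [div_lt_one (by positivity)]; exact hlt
        simp only [hΦ, hs, hq, hl, if_true, mul_assoc]
        exact le_rfl
      · exact absurd ⟨lt_of_le_of_lt (Real.sqrt_nonneg _) a, b⟩ c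
      · simp
      · simp
      · simp
      · simp
    · have hpm : Measurable (fun p : ℝ × ℝ => polarCoord.symm p) := by
        simp only [polarCoord_symm_apply]; fun_prop
      exact ((measurable_fst.ennreal_ofReal).mul (hmeas.comp hpm)).aemeasurable
  refine (lintegral_mono h1).trans ?_
  rw [lintegral_lintegral_swap]
  · calc ∫⁻ ρ in Ioo (0:ℝ) 1, ∫⁻ z : Fin k → ℝ, ENNReal.ofReal ρ * Φ (ρ⁻¹ • z)
        ≤ ∫⁻ ρ in Ioo (0:ℝ) 1, ∫⁻ w, Φ w := by
          apply setLIntegral_mono' measurableSet_Ioo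
          intro ρ hρ
          have h0 : 0 < ρ := hρ.1
          rw [lintegral_const_mul' _ _ ENNReal.ofReal_ne_top]
          have e := Measure.map_addHaar_smul (volume : Measure (Fin k → ℝ)) (inv_ne_zero h0.ne')
          rw [← lintegral_map (f := Φ) hΦm (measurable_const_smul ρ⁻¹), e, lintegral_smul_measure,
            smul_eq_mul, ← mul_assoc, ← ENNReal.ofReal_mul h0.le]
          apply mul_le_of_le_one_left zero_le
          rw [ENNReal.ofReal_le_one, abs_of_pos (by positivity), inv_pow, inv_inv, ← pow_succ']
          exact pow_le_one₀ h0.le hρ.2.le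
      _ = _ := by simp
  · apply Measurable.aemeasurable
    apply Measurable.mul
    · fun_prop
    · apply hΦm.comp
      fun_prop

theorem lemP (F : ℝ → ℝ≥0∞) (hF : ∀ x, F (x + 2 * π) = F x) :
    ∫⁻ θ in Ioo (-π) π, F θ = ∫⁻ θ in Ioc 0 (2 * π), F θ := by
  have h := IsAddFundamentalDomain.setLIntegral_eq
    (isAddFundamentalDomain_Ioc Real.two_pi_pos (-π))
    (isAddFundamentalDomain_Ioc Real.two_pi_pos 0) F (by
      have hp : Function.Periodic F (2 * π) := hF
      rintro ⟨g, n, rfl⟩ x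
      have := hp.zsmul n x
      simpa [AddSubgroup.vadd_def, add_comm] using this)
  rw [zero_add, show -π + 2 * π = π by ring] at h
  rw [← h]
  exact setLIntegral_congr Ioo_ae_eq_Ioc

theorem mainBound (k : ℕ) (f : Fin (k+2) → ℝ → ℝ) (hf : ∀ i, Measurable (f i)) (x t : ℝ)
    (ht : 0 < t) :
    (∫⁻ y : Metric.sphere (0 : EuclideanSpace ℝ (Fin (k+2))) 1,
      ∏ i, ENNReal.ofReal |f i (x - t * (y : EuclideanSpace ℝ (Fin (k+2))) i)|
        ∂(volume : Measure (EuclideanSpace ℝ (Fin (k+2)))).toSphere) *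
        ENNReal.ofReal (1 / ((k+2 : ℕ) : ℝ)) ≤
      ENNReal.ofReal (2 * π) * (S2 (f 0) (f 1) x * Mk k (fun i => f i.succ.succ) x) := by
  set G : (Fin (k+2) → ℝ) → ℝ≥0∞ := fun v => ∏ i, ENNReal.ofReal |f i (x - t * v i)| with hG
  have hGm : Measurable G := by
    apply Finset.measurable_fun_prod
    intro i _
    have := hf i
    fun_prop
  have hA := lemA (volume : Measure (EuclideanSpace ℝ (Fin (k+2)))) (fun y => G (fun i => y i))
    (by apply hGm.comp; fun_prop)
  rw [finrank_euclideanSpace_fin] at hA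
  rw [← hA]
  set H : (Fin (k+2) → ℝ) → ℝ≥0∞ := fun v =>
    if √(∑ i, v i ^ 2) < 1 then G ((√(∑ i, v i ^ 2))⁻¹ • v) else 0 with hH
  have hHm : Measurable H := by
    refine Measurable.ite (measurableSet_lt (by fun_prop) measurable_const) ?_ measurable_const
    apply hGm.comp
    fun_prop
  have hB := lemB k H hHm
  have e1 : ∫⁻ y : EuclideanSpace ℝ (Fin (k+2)),
      (if ‖y‖ < 1 then G (fun i => (‖y‖⁻¹ • y) i) else 0) =
      ∫⁻ y : EuclideanSpace ℝ (Fin (k+2)), H (fun i => y i) := by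
    apply lintegral_congr
    intro y
    simp only [hH, EuclideanSpace.norm_eq, Real.norm_eq_abs, sq_abs]
    rfl
  rw [e1, hB]
  set V : (Fin k → ℝ) → ℝ≥0∞ := fun z => ∏ i, ENNReal.ofReal |f i.succ.succ (x - t * z i)| with hV
  have hVm : Measurable V := by
    apply Finset.measurable_fun_prod
    intro i _
    have := hf i.succ.succ
    fun_prop
  have hc := core k (fun q => ENNReal.ofReal (|f 0 (x - t * q.1.1)| * |f 1 (x - t * q.1.2)|) * V q.2)
    (by
      have := hf 0
      have := hf 1
      fun_prop)
  have e2 : ∀ (z : Fin k → ℝ) (p : ℝ × ℝ), H (Fin.cons p.1 (Fin.cons p.2 z)) =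
      (if √(p.1^2 + p.2^2 + ∑ i, z i ^ 2) < 1 then
        ENNReal.ofReal (|f 0 (x - t * ((√(p.1^2 + p.2^2 + ∑ i, z i ^ 2))⁻¹ * p.1))| *
          |f 1 (x - t * ((√(p.1^2 + p.2^2 + ∑ i, z i ^ 2))⁻¹ * p.2))|) *
          V ((√(p.1^2 + p.2^2 + ∑ i, z i ^ 2))⁻¹ • z) else 0) := by
    intro z p
    have hs : ∑ i, (Fin.cons p.1 (Fin.cons p.2 z) : Fin (k+2) → ℝ) i ^ 2 =
        p.1^2 + p.2^2 + ∑ i, z i ^ 2 := by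
      simp [Fin.sum_univ_succ, add_assoc]
    simp only [hH, hs]
    congr 1
    simp only [hG, hV, Pi.smul_apply, smul_eq_mul]
    rw [Fin.prod_univ_succ, Fin.prod_univ_succ, ENNReal.ofReal_mul (abs_nonneg _), mul_assoc]
    simp
  simp only [e2]
  refine hc.trans ?_
  have hpw : ∀ w : Fin k → ℝ, (if ∑ i, w i ^ 2 < 1 then
      ∫⁻ θ in Ioo (-π) π, ENNReal.ofReal (|f 0 (x - t * (√(1 - ∑ i, w i ^ 2) * cos θ))| *
        |f 1 (x - t * (√(1 - ∑ i, w i ^ 2) * sin θ))|) * V w else 0) ≤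
      ENNReal.ofReal (2 * π) * S2 (f 0) (f 1) x * (if ∑ i, w i ^ 2 < 1 then V w else 0) := by
    intro w
    split_ifs with hw
    · have hs : 0 < √(1 - ∑ i, w i ^ 2) := Real.sqrt_pos.2 (by linarith)
      have m0 := hf 0
      have m1 := hf 1
      rw [lintegral_mul_const _ (by fun_prop)]
      gcongr
      rw [lemP _ (by intro θ; simp)]
      have hle : (ENNReal.ofReal (2 * π))⁻¹ * ∫⁻ θ in Set.Ioc (0 : ℝ) (2 * π),
          ENNReal.ofReal (|f 0 (x - t * (√(1 - ∑ i, w i ^ 2) * cos θ))| *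
        |f 1 (x - t * (√(1 - ∑ i, w i ^ 2) * sin θ))|) ≤ S2 (f 0) (f 1) x := by
        unfold S2
        refine le_trans (le_of_eq ?_) (le_iSup₂ (t * √(1 - ∑ i, w i ^ 2)) (mul_pos ht hs))
        simp only [mul_assoc]
      refine le_trans (le_of_eq ?_) (mul_le_mul_right hle _)
      rw [← mul_assoc, ENNReal.mul_inv_cancel, one_mul]
      · simpa using Real.pi_pos
      · exact ENNReal.ofReal_ne_top
    · simp
  refine (lintegral_mono hpw).trans ?_
  rw [lintegral_const_mul _ (Measurable.ite (measurableSet_lt (by fun_prop) measurable_const)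
    hVm measurable_const), mul_assoc]
  gcongr
  unfold Mk
  refine le_trans (le_of_eq ?_) (le_iSup₂ t ht)
  rw [← ((EuclideanSpace.volume_preserving_symm_measurableEquiv_toLp (Fin k))).lintegral_comp_emb
      (MeasurableEquiv.measurableEmbedding _), ← lintegral_indicator Metric.isOpen_ball.measurableSet]
  apply lintegral_congr
  intro y
  have hb : y ∈ Metric.ball (0 : EuclideanSpace ℝ (Fin k)) 1 ↔ ∑ i, y i ^ 2 < 1 := by
    rw [mem_ball_zero_iff, EuclideanSpace.norm_eq, Real.sqrt_lt' one_pos]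
    simp
  by_cases h : ∑ i, y i ^ 2 < 1
  · rw [indicator_of_mem (hb.2 h)]
    exact if_pos h
  · rw [indicator_of_notMem (fun h' => h (hb.1 h'))]
    exact if_neg h

/-- For `m ≥ 3` and nonnegative measurable `f₁,…,f_m`, the multilinear
spherical average is pointwise dominated by `S²(f₁,f₂) ⋅ M^{m-2}(f₃,…,f_m)`, uniformly in
`t > 0`; consequently the same domination holds for the maximal function `S^m`. -/
theorem multilinear_spherical_pointwise_domination
    (m : ℕ) (hm : 3 ≤ m) :
    ∃ C : ℝ, 0 < C ∧ ∀ f : Fin m → ℝ → ℝ, (∀ i, Measurable (f i)) → (∀ i x, 0 ≤ f i x) →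
      (∀ x t : ℝ, 0 < t →
        sphAvg m f t x ≤ ENNReal.ofReal C *
          (S2 (f ⟨0, by omega⟩) (f ⟨1, by omega⟩) x *
            Mk (m - 2) (fun i => f ⟨i.1 + 2, by have := i.isLt; omega⟩) x)) ∧
      (∀ x : ℝ,
        Sm m f x ≤ ENNReal.ofReal C *
          (S2 (f ⟨0, by omega⟩) (f ⟨1, by omega⟩) x *
            Mk (m - 2) (fun i => f ⟨i.1 + 2, by have := i.isLt; omega⟩) x)) := by
  obtain ⟨k, rfl⟩ : ∃ k, m = k + 2 := ⟨m - 2, by omega⟩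
  set c : ℝ≥0∞ := (volume : Measure (EuclideanSpace ℝ (Fin (k+2)))).toSphere Set.univ with hc
  have hc0 : c ≠ 0 := by
    rw [hc, Ne, Measure.measure_univ_eq_zero]
    exact Measure.toSphere_ne_zero _
  have hct : c ≠ ∞ := measure_ne_top _ _
  have hcp : 0 < c.toReal := ENNReal.toReal_pos hc0 hct
  have main : ∀ f : Fin (k+2) → ℝ → ℝ, (∀ i, Measurable (f i)) → ∀ x t : ℝ, 0 < t →
      sphAvg (k+2) f t x ≤ ENNReal.ofReal (c.toReal⁻¹ * (((k+2 : ℕ) : ℝ) * (2 * π))) *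
        (S2 (f 0) (f 1) x * Mk k (fun i => f i.succ.succ) x) := by
    intro f hf x t ht
    have h := mainBound k f hf x t ht
    have h2 := mul_le_mul_left h (ENNReal.ofReal ((k+2 : ℕ) : ℝ))
    have h3 : ENNReal.ofReal (1 / ((k+2 : ℕ) : ℝ)) * ENNReal.ofReal ((k+2 : ℕ) : ℝ) = 1 := by
      rw [← ENNReal.ofReal_mul (by positivity), one_div_mul_cancel (by positivity)]
      simp
    rw [mul_assoc, h3, mul_one] at h2
    unfold sphAvg sphMeasure
    rw [lintegral_smul_measure, smul_eq_mul]
    refine (mul_le_mul_right h2 _).trans (le_of_eq ?_)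
    rw [← hc, ENNReal.ofReal_mul (p := c.toReal⁻¹) (by positivity), ENNReal.ofReal_mul (p := ((k+2 : ℕ) : ℝ)) (by positivity),
      ENNReal.ofReal_inv_of_pos hcp, ENNReal.ofReal_toReal hct]
    generalize ENNReal.ofReal (2 * π) = a
    ring
  refine ⟨c.toReal⁻¹ * (((k+2 : ℕ) : ℝ) * (2 * π)), by positivity, fun f hf _ => ⟨?_, ?_⟩⟩
  · intro x t ht
    exact main f hf x t ht
  · intro x
    unfold Sm
    exact iSup₂_le fun t ht => main f hf x t ht
end
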